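/- Let f be a multicritical circle map with irrational rotation number. There exists a constant C > 1, depending only on f, such that for all n ≥ 0 and each pair of adjacent atoms I, J of the n-th dynamical partition P_n one has C^{-1}|J| ≤ |I| ≤ C|J|. In particular, there exists μ = μ(f) ∈ (0,1) such that whenever Δ is an atom of P_{n+2} contained in an atom Δ' of P_n, one has |Δ| < μ|Δ'| for all n ∈ ℕ. -/

import Mathlib

open Set Filter Topology
open scoped ENNReal

noncomputable section

namespace MCircle

/-- A lift of an orientation-preserving `C³` circle homeomorphism of `S¹ = ℝ/ℤ`:
a `C³`, strictly increasing map commuting with the unit translation. -/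
structure IsCircleMapLift (f : ℝ → ℝ) : Prop where
  smooth : ContDiff ℝ 3 f
  mono : StrictMono f
  periodic : ∀ x : ℝ, f (x + 1) = f x + 1

/-- `c` is a non-flat (power-law) critical point of `f` of criticality `d > 1`:
near `c` we have `f x = f c + φ x * |φ x| ^ (d - 1)` for a `C³` diffeomorphism `φ`
of a neighbourhood `W` of `c` with `φ c = 0`. -/
def IsNonFlatCritPt (f : ℝ → ℝ) (c d : ℝ) : Prop :=
  1 < d ∧ ∃ (W : Set ℝ) (φ : ℝ → ℝ), IsOpen W ∧ c ∈ W ∧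
    ContDiffOn ℝ 3 φ W ∧ φ c = 0 ∧ (∀ x ∈ W, deriv φ x ≠ 0) ∧ InjOn φ W ∧
    ∀ x ∈ W, f x = f c + φ x * |φ x| ^ (d - 1)

/-- `f` is (a lift of) a multicritical circle map: the set of critical points of the
induced circle map, represented in `[0,1)`, is the nonempty finite set `C`, and each
critical point `c ∈ C` is non-flat of criticality `dc c`. -/
def IsMulticriticalLift (f : ℝ → ℝ) (C : Finset ℝ) (dc : ℝ → ℝ) : Prop :=
  IsCircleMapLift f ∧ C.Nonempty ∧ (↑C : Set ℝ) ⊆ Ico (0 : ℝ) 1 ∧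
    (∀ x : ℝ, deriv f x = 0 ↔ ∃ c ∈ C, ∃ k : ℤ, x = c + (k : ℝ)) ∧
    ∀ c ∈ C, IsNonFlatCritPt f c (dc c)

/-- The lift `f` has (translation) rotation number `ρ`. -/
def HasRotNumber (f : ℝ → ℝ) (ρ : ℝ) : Prop :=
  Tendsto (fun n : ℕ => f^[n] 0 / (n : ℝ)) atTop (𝓝 ρ)

/-- `f` is (a lift of) a multicritical circle map with critical set `C` (criticalities
`dc`) and irrational rotation number `ρ`, the lift being normalized so that `ρ ∈ (0,1)`. -/
def GoodMap (f : ℝ → ℝ) (C : Finset ℝ) (dc : ℝ → ℝ) (ρ : ℝ) : Prop :=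
  IsMulticriticalLift f C dc ∧ HasRotNumber f ρ ∧ Irrational ρ ∧ ρ ∈ Ioo (0 : ℝ) 1

/-- The Gauss map. -/
def gaussMap (x : ℝ) : ℝ := Int.fract x⁻¹

/-- The partial quotients `aₙ` of the continued fraction expansion
`ρ = [a₀, a₁, …] = 1/(a₀ + 1/(a₁ + ⋯))`. -/
def cfA (ρ : ℝ) (n : ℕ) : ℕ := ⌊(gaussMap^[n] (Int.fract ρ))⁻¹⌋₊

/-- The denominators `qₙ` of the convergents of `ρ` (the return times):
`q₀ = 1`, `q₁ = a₀`, `q_{n+2} = a_{n+1} q_{n+1} + qₙ`. -/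
def qden (ρ : ℝ) : ℕ → ℕ
  | 0 => 1
  | 1 => cfA ρ 0
  | n + 2 => cfA ρ (n + 1) * qden ρ (n + 1) + qden ρ n

/-- The numerators `pₙ` of the convergents of `ρ`:
`p₀ = 0`, `p₁ = 1`, `p_{n+2} = a_{n+1} p_{n+1} + pₙ`. -/
def pnum (ρ : ℝ) : ℕ → ℕ
  | 0 => 0
  | 1 => 1
  | n + 2 => cfA ρ (n + 1) * pnum ρ (n + 1) + pnum ρ n

/-- The lift representative of the `n`-th closest return `f^{qₙ}(x)`,
normalized (by the integer `pₙ`) to lie at distance less than one from `x`. -/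
def retPt (f : ℝ → ℝ) (ρ x : ℝ) (n : ℕ) : ℝ := f^[qden ρ n] x - (pnum ρ n : ℝ)

/-- The arc `Iₙ(x)`, with endpoints `x` and `f^{qₙ}(x)` and containing `f^{q_{n+2}}(x)`,
realized as an interval in the lift. -/
def arcI (f : ℝ → ℝ) (ρ x : ℝ) (n : ℕ) : Set ℝ := uIcc x (retPt f ρ x n)

/-- The length `|Iₙ(x)|`. -/
def arcLen (f : ℝ → ℝ) (ρ x : ℝ) (n : ℕ) : ℝ := |retPt f ρ x n - x|

/-- The length `|f^j(Iₙ(x))|`. -/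
def arcImgLen (f : ℝ → ℝ) (ρ x : ℝ) (n j : ℕ) : ℝ :=
  |f^[j] (retPt f ρ x n) - f^[j] x|

/-- Indices for the atoms of the `n`-th dynamical partition
`𝒫ₙ(x) = {fⁱ(Iₙ(x)) : 0 ≤ i ≤ q_{n+1}-1} ∪ {f^j(I_{n+1}(x)) : 0 ≤ j ≤ qₙ-1}`. -/
abbrev AtomIdx (ρ : ℝ) (n : ℕ) : Type :=
  {i : ℕ // i < qden ρ (n + 1)} ⊕ {j : ℕ // j < qden ρ n}

/-- Left endpoint (in the lift) of an atom of `𝒫ₙ(x)`. -/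
def atomL (f : ℝ → ℝ) (ρ x : ℝ) (n : ℕ) : AtomIdx ρ n → ℝ
  | Sum.inl i => min (f^[i.1] x) (f^[i.1] (retPt f ρ x n))
  | Sum.inr j => min (f^[j.1] x) (f^[j.1] (retPt f ρ x (n + 1)))

/-- Right endpoint (in the lift) of an atom of `𝒫ₙ(x)`. -/
def atomR (f : ℝ → ℝ) (ρ x : ℝ) (n : ℕ) : AtomIdx ρ n → ℝ
  | Sum.inl i => max (f^[i.1] x) (f^[i.1] (retPt f ρ x n))
  | Sum.inr j => max (f^[j.1] x) (f^[j.1] (retPt f ρ x (n + 1)))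

/-- Length of an atom of `𝒫ₙ(x)`. -/
def atomLen (f : ℝ → ℝ) (ρ x : ℝ) (n : ℕ) (A : AtomIdx ρ n) : ℝ :=
  atomR f ρ x n A - atomL f ρ x n A

/-- Two lift points represent the same point of the circle `ℝ/ℤ`. -/
def SameCirclePt (a b : ℝ) : Prop := ∃ m : ℤ, a = b + (m : ℝ)

/-- Two atoms of `𝒫ₙ(x)` are adjacent: they are distinct and share an endpoint
on the circle. -/
def AdjacentAtoms (f : ℝ → ℝ) (ρ x : ℝ) (n : ℕ) (A B : AtomIdx ρ n) : Prop :=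
  A ≠ B ∧ ∃ p ∈ ({atomL f ρ x n A, atomR f ρ x n A} : Set ℝ),
    ∃ q ∈ ({atomL f ρ x n B, atomR f ρ x n B} : Set ℝ), SameCirclePt p q

/-- `A` is the left neighbour of `Δ` in `𝒫ₙ(x)`. -/
def IsLeftNbr (f : ℝ → ℝ) (ρ x : ℝ) (n : ℕ) (A Δ : AtomIdx ρ n) : Prop :=
  A ≠ Δ ∧ SameCirclePt (atomR f ρ x n A) (atomL f ρ x n Δ)

/-- `B` is the right neighbour of `Δ` in `𝒫ₙ(x)`. -/
def IsRightNbr (f : ℝ → ℝ) (ρ x : ℝ) (n : ℕ) (B Δ : AtomIdx ρ n) : Prop :=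
  B ≠ Δ ∧ SameCirclePt (atomL f ρ x n B) (atomR f ρ x n Δ)

/-- The arc `f^j(Δ)` is contained (as a circle arc) in some element of `𝒫ₙ(x)`. -/
def ImgInAtom (f : ℝ → ℝ) (ρ x : ℝ) (n j : ℕ) (Δ : AtomIdx ρ n) : Prop :=
  ∃ E : AtomIdx ρ n, ∃ m : ℤ,
    atomL f ρ x n E + (m : ℝ) ≤ f^[j] (atomL f ρ x n Δ) ∧
    f^[j] (atomR f ρ x n Δ) ≤ atomR f ρ x n E + (m : ℝ)

/-- An atom of `𝒫ₙ(x)` as a subset of the circle `ℝ/ℤ`. -/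
def atomSetC (f : ℝ → ℝ) (ρ x : ℝ) (n : ℕ) (A : AtomIdx ρ n) : Set (AddCircle (1 : ℝ)) :=
  (fun y : ℝ => (y : AddCircle (1 : ℝ))) '' Icc (atomL f ρ x n A) (atomR f ρ x n A)

/-- The interval `Tₙ = I_{n+1} ∪ Iₙ ∪ f^{qₙ}(Iₙ)`, realized in the lift. -/
def Tset (f : ℝ → ℝ) (ρ x : ℝ) (n : ℕ) : Set ℝ :=
  arcI f ρ x (n + 1) ∪ arcI f ρ x n ∪
    (fun z => f^[qden ρ n] z - (pnum ρ n : ℝ)) '' arcI f ρ x n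

/-- `j` is a critical time: `f^j(Tₙ)` contains a critical point of `f` (mod 1). -/
def IsCritTime (f : ℝ → ℝ) (ρ x : ℝ) (C : Finset ℝ) (n j : ℕ) : Prop :=
  ∃ c ∈ C, ∃ m : ℤ, c + (m : ℝ) ∈ f^[j] '' Tset f ρ x n

/-- The cross-ratio `[M,T] = |L||R|/(|L∪M||M∪R|)` of the configuration
`M = [b,c] ⋐ T = [a,d]` (so `L = [a,b]`, `R = [c,d]`). -/
def crossRatio (a b c d : ℝ) : ℝ := ((b - a) * (d - c)) / ((c - a) * (d - b))

/-- The cross-ratio distortion `CrD(g; M, T)` of `g` on the configuration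
`M = [b,c] ⋐ T = [a,d]`. -/
def crD (g : ℝ → ℝ) (a b c d : ℝ) : ℝ :=
  crossRatio (g a) (g b) (g c) (g d) / crossRatio a b c d

/-- The Schwarzian derivative `Sg = g'''/g' - (3/2)(g''/g')²`. -/
def schwarzian (g : ℝ → ℝ) (x : ℝ) : ℝ :=
  iteratedDeriv 3 g x / deriv g x - (3 / 2) * (iteratedDeriv 2 g x / deriv g x) ^ 2

/-- `g` is a diffeomorphism on `S` with distortion bounded by `K`. -/
def DiffeoWithDistortionLE (g : ℝ → ℝ) (S : Set ℝ) (K : ℝ) : Prop :=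
  ContDiffOn ℝ 1 g S ∧ InjOn g S ∧ (∀ x ∈ S, deriv g x ≠ 0) ∧
    ∀ x ∈ S, ∀ y ∈ S, |deriv g x| ≤ K * |deriv g y|

/-- `g` is a diffeomorphism on `S` with negative Schwarzian derivative. -/
def NegSchwarzDiffeoOn (g : ℝ → ℝ) (S : Set ℝ) : Prop :=
  ContDiffOn ℝ 3 g S ∧ InjOn g S ∧ ∀ x ∈ S, deriv g x ≠ 0 ∧ schwarzian g x < 0

/-- The local quasi-symmetric distortion
`σ_h(x) = lim_{δ→0} limsup_{|t|≤δ} |h(x+t)-h(x)|/|h(x)-h(x-t)|` of a circle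
homeomorphism lift `h`, with values in `[0,∞]`. -/
def qsDistortion (h : ℝ → ℝ) (x : ℝ) : ℝ≥0∞ :=
  Filter.limsup
    (fun t : ℝ => ENNReal.ofReal (|h (x + t) - h x| / |h x - h (x - t)|))
    (𝓝[≠] (0 : ℝ))

end MCircle

namespace MCircle

/-! ### Cross-ratios and the power map -/

lemma sinh_mul_cosh_le {d x : ℝ} (hd : 1 ≤ d) (hx : 0 ≤ x) :
    Real.sinh (d * x) * Real.cosh x ≤ d * Real.cosh (d * x) * Real.sinh x := by
  have hder : ∀ y : ℝ, HasDerivAt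
      (fun y => d * Real.cosh (d * y) * Real.sinh y - Real.sinh (d * y) * Real.cosh y)
      ((d ^ 2 - 1) * (Real.sinh (d * y) * Real.sinh y)) y := by
    intro y
    have h0 : HasDerivAt (fun y : ℝ => d * y) d y := by
      simpa using (hasDerivAt_id y).const_mul d
    have h1 := (h0.cosh.const_mul d).mul (Real.hasDerivAt_sinh y)
    have h2 := h0.sinh.mul (Real.hasDerivAt_cosh y)
    refine (h1.sub h2).congr_deriv ?_
    ring
  have hmono : MonotoneOn
      (fun y => d * Real.cosh (d * y) * Real.sinh y - Real.sinh (d * y) * Real.cosh y)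
      (Ici 0) := by
    refine monotoneOn_of_deriv_nonneg (convex_Ici 0)
      (fun y _ => (hder y).continuousAt.continuousWithinAt)
      (fun y _ => (hder y).differentiableAt.differentiableWithinAt) ?_
    intro y hy
    rw [interior_Ici] at hy
    rw [(hder y).deriv]
    have hy' : 0 < y := hy
    have h1 : 0 ≤ Real.sinh y := Real.sinh_nonneg_iff.2 hy'.le
    have h2 : 0 ≤ Real.sinh (d * y) := Real.sinh_nonneg_iff.2 (by positivity)
    have h3 : 0 ≤ d ^ 2 - 1 := by nlinarith
    positivity
  have := hmono (show (0 : ℝ) ∈ Ici 0 by simp) (show x ∈ Ici 0 from hx) hx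
  simp at this
  linarith

lemma sinh_mul_le_sinh_mul {d x y : ℝ} (hd : 1 ≤ d) (hx : 0 < x) (hxy : x ≤ y) :
    Real.sinh (d * x) / Real.sinh x ≤ Real.sinh (d * y) / Real.sinh y := by
  have hder : ∀ y : ℝ, 0 < y → HasDerivAt (fun y => Real.sinh (d * y) / Real.sinh y)
      ((Real.cosh (d * y) * d * Real.sinh y - Real.sinh (d * y) * Real.cosh y) /
        Real.sinh y ^ 2) y := by
    intro y hy
    have h0 : HasDerivAt (fun y : ℝ => d * y) d y := by
      simpa using (hasDerivAt_id y).const_mul d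
    exact h0.sinh.div (Real.hasDerivAt_sinh y) (Real.sinh_pos_iff.2 hy).ne'
  have hmono : MonotoneOn (fun y => Real.sinh (d * y) / Real.sinh y) (Ioi 0) := by
    refine monotoneOn_of_deriv_nonneg (convex_Ioi 0)
      (fun y hy => (hder y hy).continuousAt.continuousWithinAt)
      (fun y hy => (hder y (interior_subset hy)).differentiableAt.differentiableWithinAt) ?_
    intro y hy
    have hy' : 0 < y := interior_subset hy
    rw [(hder y hy').deriv]
    have := sinh_mul_cosh_le hd hy'.le
    apply div_nonneg _ (sq_nonneg _)
    linarith
  exact hmono hx (lt_of_lt_of_le hx hxy) hxy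

lemma exp_sub_exp_eq_sinh (x y : ℝ) :
    Real.exp y - Real.exp x = 2 * Real.exp ((x + y) / 2) * Real.sinh ((y - x) / 2) := by
  rw [Real.sinh_eq]
  have h1 : Real.exp y = Real.exp ((x + y) / 2) * Real.exp ((y - x) / 2) := by
    rw [← Real.exp_add]; congr 1; ring
  have h2 : Real.exp x = Real.exp ((x + y) / 2) * Real.exp (-((y - x) / 2)) := by
    rw [← Real.exp_add]; congr 1; ring
  rw [h1, h2]; ring

lemma crossRatio_exp {α β γ δ : ℝ} :
    crossRatio (Real.exp α) (Real.exp β) (Real.exp γ) (Real.exp δ) =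
      (Real.sinh ((β - α) / 2) * Real.sinh ((δ - γ) / 2)) /
        (Real.sinh ((γ - α) / 2) * Real.sinh ((δ - β) / 2)) := by
  unfold crossRatio
  rw [exp_sub_exp_eq_sinh α β, exp_sub_exp_eq_sinh γ δ, exp_sub_exp_eq_sinh α γ,
    exp_sub_exp_eq_sinh β δ]
  have h1 : Real.exp ((α + β) / 2) * Real.exp ((γ + δ) / 2) =
      Real.exp ((α + γ) / 2) * Real.exp ((β + δ) / 2) := by
    rw [← Real.exp_add, ← Real.exp_add]; congr 1; ring
  have h2 : (4 * (Real.exp ((α + γ) / 2) * Real.exp ((β + δ) / 2))) ≠ 0 := by positivity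
  rw [show 2 * Real.exp ((α + β) / 2) * Real.sinh ((β - α) / 2) *
      (2 * Real.exp ((γ + δ) / 2) * Real.sinh ((δ - γ) / 2)) =
      (4 * (Real.exp ((α + γ) / 2) * Real.exp ((β + δ) / 2))) *
        (Real.sinh ((β - α) / 2) * Real.sinh ((δ - γ) / 2)) by rw [← h1]; ring,
    show 2 * Real.exp ((α + γ) / 2) * Real.sinh ((γ - α) / 2) *
      (2 * Real.exp ((β + δ) / 2) * Real.sinh ((δ - β) / 2)) =
      (4 * (Real.exp ((α + γ) / 2) * Real.exp ((β + δ) / 2))) *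
        (Real.sinh ((γ - α) / 2) * Real.sinh ((δ - β) / 2)) by ring,
    mul_div_mul_left _ _ h2]

lemma crossRatio_rpow_le {t a b c d : ℝ} (ht : 1 ≤ t) (ha : 0 < a) (hab : a < b) (hbc : b < c)
    (hcd : c < d) :
    crossRatio (a ^ t) (b ^ t) (c ^ t) (d ^ t) ≤ crossRatio a b c d := by
  have key : ∀ x : ℝ, 0 < x → x ^ t = Real.exp (t * Real.log x) := by
    intro x hx; rw [Real.rpow_def_of_pos hx, mul_comm]
  have hb := ha.trans hab
  have hc := hb.trans hbc
  have hd := hc.trans hcd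
  have l1 := Real.log_lt_log ha hab
  have l2 := Real.log_lt_log hb hbc
  have l3 := Real.log_lt_log hc hcd
  have e : crossRatio a b c d = crossRatio (Real.exp (Real.log a)) (Real.exp (Real.log b))
      (Real.exp (Real.log c)) (Real.exp (Real.log d)) := by
    rw [Real.exp_log ha, Real.exp_log hb, Real.exp_log hc, Real.exp_log hd]
  rw [e, key a ha, key b hb, key c hc, key d hd, crossRatio_exp, crossRatio_exp]
  set α := Real.log a
  set β := Real.log b
  set γ := Real.log c
  set δ := Real.log d
  have main : ∀ x y : ℝ, 0 < x → x ≤ y →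
      0 ≤ Real.sinh (t * x) / Real.sinh (t * y) ∧
      Real.sinh (t * x) / Real.sinh (t * y) ≤ Real.sinh x / Real.sinh y := by
    intro x y hx hxy
    have hy := hx.trans_le hxy
    have := sinh_mul_le_sinh_mul ht hx hxy
    have h1 := Real.sinh_pos_iff.2 hx
    have h2 := Real.sinh_pos_iff.2 hy
    have h3 : 0 < Real.sinh (t * y) := Real.sinh_pos_iff.2 (by positivity)
    have h4 : 0 < Real.sinh (t * x) := Real.sinh_pos_iff.2 (by positivity)
    refine ⟨by positivity, ?_⟩
    rw [div_le_div_iff₀ h1 h2] at this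
    rw [div_le_div_iff₀ h3 h2]
    linarith
  have m1 := main ((β - α) / 2) ((γ - α) / 2) (by linarith) (by linarith)
  have m2 := main ((δ - γ) / 2) ((δ - β) / 2) (by linarith) (by linarith)
  rw [mul_div_mul_comm, mul_div_mul_comm]
  rw [show (t * β - t * α) / 2 = t * ((β - α) / 2) by ring,
    show (t * γ - t * α) / 2 = t * ((γ - α) / 2) by ring,
    show (t * δ - t * γ) / 2 = t * ((δ - γ) / 2) by ring,
    show (t * δ - t * β) / 2 = t * ((δ - β) / 2) by ring]
  exact mul_le_mul m1.2 m2.2 m2.1 (m1.1.trans m1.2)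

lemma crossRatio_reverse (a b c d : ℝ) : crossRatio d c b a = crossRatio a b c d := by
  unfold crossRatio
  rw [show (c - d) * (a - b) = (b - a) * (d - c) by ring,
    show (b - d) * (a - c) = (c - a) * (d - b) by ring]

lemma crossRatio_neg (a b c d : ℝ) : crossRatio (-a) (-b) (-c) (-d) = crossRatio a b c d := by
  unfold crossRatio
  rw [show (-b - -a) * (-d - -c) = (b - a) * (d - c) by ring,
    show (-c - -a) * (-d - -b) = (c - a) * (d - b) by ring]

lemma crossRatio_add_const (a b c d t : ℝ) :
    crossRatio (a + t) (b + t) (c + t) (d + t) = crossRatio a b c d := by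
  simp [crossRatio]

lemma crossRatio_pos {a b c d : ℝ} (hab : a < b) (hbc : b < c) (hcd : c < d) :
    0 < crossRatio a b c d := by
  unfold crossRatio
  have := sub_pos.2 hab
  have := sub_pos.2 hcd
  have := sub_pos.2 (hab.trans hbc)
  have := sub_pos.2 (hbc.trans hcd)
  positivity

/-- The odd power map `x ↦ x |x|^(d-1)`. -/
def oddPow (d x : ℝ) : ℝ := x * |x| ^ (d - 1)

lemma oddPow_neg (d x : ℝ) : oddPow d (-x) = -oddPow d x := by simp [oddPow]

lemma oddPow_of_nonneg {d x : ℝ} (hd : 0 < d) (hx : 0 ≤ x) : oddPow d x = x ^ d := by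
  unfold oddPow
  rw [abs_of_nonneg hx]
  rcases hx.eq_or_lt with rfl | hx
  · simp [hd.ne']
  · rw [Real.rpow_sub_one hx.ne']; field_simp

lemma oddPow_strictMono {d : ℝ} (hd : 0 < d) : StrictMono (oddPow d) := by
  have hpos : ∀ x y : ℝ, 0 ≤ x → x < y → oddPow d x < oddPow d y := by
    intro x y hx hxy
    rw [oddPow_of_nonneg hd hx, oddPow_of_nonneg hd (hx.trans hxy.le)]
    exact Real.rpow_lt_rpow hx hxy hd
  intro x y hxy
  rcases le_or_gt 0 x with hx | hx
  · exact hpos x y hx hxy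
  · rcases le_or_gt y 0 with hy | hy
    · have := hpos (-y) (-x) (by linarith) (by linarith)
      rw [oddPow_neg, oddPow_neg] at this
      linarith
    · have h1 := hpos 0 y le_rfl hy
      have h2 := hpos 0 (-x) le_rfl (by linarith)
      rw [oddPow_neg] at h2
      have h3 : oddPow d 0 = 0 := by simp [oddPow]
      linarith

lemma abs_oddPow {d : ℝ} (hd : 0 < d) (x : ℝ) : |oddPow d x| = |x| ^ d := by
  rcases le_total 0 x with hx | hx
  · rw [oddPow_of_nonneg hd hx, abs_of_nonneg hx, abs_of_nonneg (by positivity)]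
  · have := oddPow_of_nonneg hd (neg_nonneg.2 hx)
    rw [oddPow_neg] at this
    rw [← abs_neg, this, abs_of_nonpos hx, abs_of_nonneg]
    exact Real.rpow_nonneg (by linarith) _

lemma crossRatio_oddPow_le {t a b c d : ℝ} (ht : 1 ≤ t) (hab : a < b) (hbc : b < c)
    (hcd : c < d) (h0 : 0 < a ∨ d < 0) :
    crossRatio (oddPow t a) (oddPow t b) (oddPow t c) (oddPow t d) ≤ crossRatio a b c d := by
  have ht0 : 0 < t := by linarith
  rcases h0 with h0 | h0
  · rw [oddPow_of_nonneg ht0 h0.le, oddPow_of_nonneg ht0 (by linarith),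
      oddPow_of_nonneg ht0 (by linarith), oddPow_of_nonneg ht0 (by linarith)]
    exact crossRatio_rpow_le ht h0 hab hbc hcd
  · have := crossRatio_rpow_le ht (show 0 < -d by linarith) (show -d < -c by linarith)
      (show -c < -b by linarith) (show -b < -a by linarith)
    rw [← oddPow_of_nonneg ht0 (by linarith), ← oddPow_of_nonneg ht0 (by linarith),
      ← oddPow_of_nonneg ht0 (by linarith), ← oddPow_of_nonneg ht0 (by linarith)] at this
    simpa only [oddPow_neg, crossRatio_neg, crossRatio_reverse] using this

lemma slope_oddPow_le {d a b : ℝ} (hd : 1 < d) (hab : a < b) :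
    slope (oddPow d) a b ≤ d * max |a| |b| ^ (d - 1) := by
  have hd0 : 0 < d := by linarith
  have hpos : ∀ x y : ℝ, 0 ≤ x → x < y → oddPow d y - oddPow d x ≤ d * y ^ (d - 1) * (y - x) := by
    intro x y hx hxy
    have hy : 0 < y := by linarith
    rw [oddPow_of_nonneg hd0 hx, oddPow_of_nonneg hd0 hy.le]
    have h := one_add_mul_self_le_rpow_one_add (s := x / y - 1) (p := d)
      (by have : 0 ≤ x / y := by positivity
          linarith) hd.le
    rw [show 1 + (x / y - 1) = x / y by ring, Real.div_rpow hx hy.le,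
      le_div_iff₀ (by positivity)] at h
    have h2 : y ^ d = y ^ (d - 1) * y := by rw [Real.rpow_sub_one hy.ne']; field_simp
    have h3 : (1 + d * (x / y - 1)) * y ^ d = y ^ d - d * y ^ (d - 1) * (y - x) := by
      rw [h2]; field_simp; ring
    linarith
  rw [slope_def_field, div_le_iff₀ (by linarith)]
  rcases le_or_gt 0 a with ha | ha
  · rw [abs_of_nonneg ha, abs_of_nonneg (ha.trans hab.le), max_eq_right hab.le]
    exact hpos a b ha hab
  · rcases le_or_gt b 0 with hb | hb
    · have := hpos (-b) (-a) (by linarith) (by linarith)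
      rw [oddPow_neg, oddPow_neg] at this
      rw [abs_of_neg ha, abs_of_nonpos hb, max_eq_left (by linarith)]
      linarith
    · have h1 : oddPow d b ≤ max |a| |b| ^ (d - 1) * b := by
        rw [oddPow, mul_comm]
        gcongr
        exact le_max_right _ _
      have h2 : -oddPow d a ≤ max |a| |b| ^ (d - 1) * (-a) := by
        rw [oddPow, mul_comm, ← mul_neg]
        gcongr
        all_goals first | exact le_max_left _ _ | linarith
      have h3 : 0 ≤ max |a| |b| ^ (d - 1) * (b - a) :=
        mul_nonneg (Real.rpow_nonneg (le_max_of_le_left (abs_nonneg _)) _) (by linarith)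
      nlinarith

lemma le_slope_oddPow {d a b : ℝ} (hd : 1 < d) (hab : a < b) :
    max |a| |b| ^ (d - 1) / 2 ≤ slope (oddPow d) a b := by
  have hd0 : 0 < d := by linarith
  have key : ∀ x y : ℝ, x < y → |x| ≤ y →
      y ^ (d - 1) / 2 * (y - x) ≤ oddPow d y - oddPow d x := by
    intro x y hxy hle
    have hy : 0 < y := by
      rcases (abs_nonneg x).trans hle |>.eq_or_lt with h | h
      · have : x = 0 := by rw [← abs_nonpos_iff, h]; exact hle
        linarith
      · exact h
    have hY : 0 ≤ y ^ (d - 1) := by positivity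
    have e : oddPow d y = y ^ (d - 1) * y := by rw [oddPow, abs_of_pos hy, mul_comm]
    rw [e]
    rcases le_or_gt 0 x with hx | hx
    · have h1 : oddPow d x ≤ y ^ (d - 1) * x := by
        rw [oddPow, mul_comm]
        gcongr
      nlinarith
    · have h1 : oddPow d x ≤ 0 := by
        have := oddPow_strictMono hd0 hx
        have h3 : oddPow d 0 = 0 := by simp [oddPow]
        linarith
      have h2 : -x ≤ y := (neg_le_abs x).trans hle
      nlinarith
  rw [slope_def_field, le_div_iff₀ (by linarith)]
  rcases le_total |a| |b| with h | h
  · rw [max_eq_right h]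
    have hb : 0 ≤ b := by
      by_contra hb
      rw [abs_of_neg (by linarith : b < 0), abs_of_neg (by linarith : a < 0)] at h
      linarith
    rw [abs_of_nonneg hb] at h ⊢
    exact key a b hab h
  · rw [max_eq_left h]
    have ha : a ≤ 0 := by
      by_contra ha
      rw [abs_of_pos (by linarith : 0 < b), abs_of_pos (by linarith : 0 < a)] at h
      linarith
    have := key (-b) (-a) (by linarith) (by rwa [abs_neg, ← abs_of_nonpos ha])
    rw [oddPow_neg, oddPow_neg] at this
    rw [abs_of_nonpos ha]
    linarith

/-! ### Distortion of slopes and cross-ratios at small scales -/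

lemma slope_pos_of_strictMono {g : ℝ → ℝ} {a b : ℝ} (hab : a < b) (h : g a < g b) :
    0 < slope g a b := by
  rw [slope_def_field]
  exact div_pos (sub_pos.2 h) (sub_pos.2 hab)

lemma crossRatio_map {g : ℝ → ℝ} {a b c d : ℝ} (hab : a < b) (hbc : b < c) (hcd : c < d) :
    crossRatio (g a) (g b) (g c) (g d) =
      slope g a b * slope g c d / (slope g a c * slope g b d) * crossRatio a b c d := by
  have h1 := (sub_pos.2 hab).ne'
  have h2 := (sub_pos.2 hcd).ne'
  have h3 := (sub_pos.2 (hab.trans hbc)).ne'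
  have h4 := (sub_pos.2 (hbc.trans hcd)).ne'
  simp only [slope_def_field, crossRatio]
  field_simp

lemma exists_slope_le_exp_mul_slope {φ : ℝ → ℝ} {x₀ : ℝ} (hφ : ContDiffAt ℝ 2 φ x₀)
    (hd : 0 < deriv φ x₀) :
    ∃ r > 0, ∃ K ≥ 0, ∀ u v : ℝ, x₀ - r < u → v < x₀ + r →
      ∀ a b a' b' : ℝ, u ≤ a → a < b → b ≤ v → u ≤ a' → a' < b' → b' ≤ v →
        0 < slope φ a b ∧ slope φ a b ≤ Real.exp (K * (v - u)) * slope φ a' b' := by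
  have h1 : ContDiffAt ℝ 1 (deriv φ) x₀ := hφ.derivWithin (m := 1) (n := 2) (by norm_num)
  have h2 : ContDiffAt ℝ 1 (fun x => Real.log (deriv φ x)) x₀ := h1.log hd.ne'
  obtain ⟨K, t, ht, hK⟩ := h2.exists_lipschitzOnWith
  have hpos : ∀ᶠ x in 𝓝 x₀, 0 < deriv φ x := h1.continuousAt.eventually_const_lt hd
  have hev : ∀ᶠ x in 𝓝 x₀, x ∈ t ∧ 0 < deriv φ x := (eventually_mem_set.2 ht).and hpos
  obtain ⟨r, hr, hball⟩ := Metric.eventually_nhds_iff_ball.1 hev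
  refine ⟨r, hr, K, K.2, ?_⟩
  intro u v hu hv a b a' b' ha hab hb ha' hab' hb'
  have hin : ∀ x, u ≤ x → x ≤ v → x ∈ t ∧ 0 < deriv φ x := by
    intro x hx1 hx2
    apply hball
    rw [Metric.mem_ball, Real.dist_eq, abs_lt]
    constructor <;> linarith
  have mvt : ∀ a b, u ≤ a → a < b → b ≤ v → ∃ ξ, u ≤ ξ ∧ ξ ≤ v ∧ slope φ a b = deriv φ ξ := by
    intro a b ha hab hb
    obtain ⟨ξ, hξ, h⟩ := exists_deriv_eq_slope φ hab
      (fun x hx => (differentiableAt_of_deriv_ne_zero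
        (hin x (ha.trans hx.1) (hx.2.trans hb)).2.ne').continuousAt.continuousWithinAt)
      (fun x hx => (differentiableAt_of_deriv_ne_zero
        (hin x (ha.trans hx.1.le) (hx.2.le.trans hb)).2.ne').differentiableWithinAt)
    refine ⟨ξ, ha.trans hξ.1.le, hξ.2.le.trans hb, ?_⟩
    rw [h, slope_def_field]
  obtain ⟨ξ, hξ1, hξ2, e⟩ := mvt a b ha hab hb
  obtain ⟨ξ', hξ1', hξ2', e'⟩ := mvt a' b' ha' hab' hb'
  rw [e, e']
  obtain ⟨m1, p1⟩ := hin ξ hξ1 hξ2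
  obtain ⟨m2, p2⟩ := hin ξ' hξ1' hξ2'
  refine ⟨p1, ?_⟩
  have h3 := hK.dist_le_mul ξ m1 ξ' m2
  rw [Real.dist_eq, Real.dist_eq] at h3
  have h4 : |ξ - ξ'| ≤ v - u := by rw [abs_le]; constructor <;> linarith
  have h5 : Real.log (deriv φ ξ) ≤ K * (v - u) + Real.log (deriv φ ξ') := by
    have := (le_abs_self _).trans h3
    have := mul_le_mul_of_nonneg_left h4 K.2
    simp only [NNReal.val_eq_coe] at this
    linarith
  calc deriv φ ξ = Real.exp (Real.log (deriv φ ξ)) := (Real.exp_log p1).symm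
    _ ≤ Real.exp (K * (v - u) + Real.log (deriv φ ξ')) := Real.exp_le_exp.2 h5
    _ = _ := by rw [Real.exp_add, Real.exp_log p2]

/-- Control of slopes and cross-ratios of `f` on all intervals within `η` of a point of `S`. -/
def SmallScaleDistortion (f : ℝ → ℝ) (S : Set ℝ) : Prop :=
  ∃ η > 0, ∃ K ≥ 0, ∀ x ∈ S, ∀ u v : ℝ, x - η < u → u < v → v < x + η →
    (∀ a b : ℝ, u ≤ a → a < b → b ≤ v → slope f a b ≤ Real.exp K * slope f u v) ∧
    ((∀ t ∈ Icc u v, deriv f t ≠ 0) → ∀ b c : ℝ, u < b → b < c → c < v →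
      crossRatio (f u) (f b) (f c) (f v) ≤ Real.exp (K * (v - u)) * crossRatio u b c v)

lemma crossRatio_map_le_of_slope_le {g : ℝ → ℝ} {E a b c d : ℝ} (hab : a < b) (hbc : b < c)
    (hcd : c < d) (hE : 0 ≤ E) (h1 : slope g a b ≤ E * slope g a c)
    (h2 : slope g c d ≤ E * slope g b d) (hac : 0 < slope g a c) (hbd : 0 < slope g b d)
    (hcd' : 0 ≤ slope g c d) :
    crossRatio (g a) (g b) (g c) (g d) ≤ E * E * crossRatio a b c d := by
  rw [crossRatio_map hab hbc hcd]
  refine mul_le_mul_of_nonneg_right ?_ (crossRatio_pos hab hbc hcd).le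
  rw [div_le_iff₀ (mul_pos hac hbd)]
  calc slope g a b * slope g c d ≤ (E * slope g a c) * (E * slope g b d) :=
        mul_le_mul h1 h2 hcd' (mul_nonneg hE hac.le)
    _ = _ := by ring

lemma smallScaleDistortion_of_deriv_pos {f : ℝ → ℝ} {x₀ : ℝ} (hf : ContDiff ℝ 3 f)
    (hd : 0 < deriv f x₀) : ∃ S ∈ 𝓝 x₀, SmallScaleDistortion f S := by
  obtain ⟨r, hr, K, hK, h⟩ := exists_slope_le_exp_mul_slope
    ((hf.of_le (by norm_num : (2 : WithTop ℕ∞) ≤ 3)).contDiffAt (x := x₀)) hd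
  refine ⟨Metric.ball x₀ (r / 2), Metric.ball_mem_nhds _ (by positivity), r / 2, by positivity,
    K * (2 * r) + 2 * K, by positivity, ?_⟩
  intro x hx u v hu huv hv
  rw [Metric.mem_ball, Real.dist_eq, abs_lt] at hx
  have h' := h u v (by linarith) (by linarith)
  refine ⟨?_, ?_⟩
  · intro a b ha hab hb
    refine (h' a b u v ha hab hb le_rfl huv le_rfl).2.trans ?_
    have := (h' u v u v le_rfl huv le_rfl le_rfl huv le_rfl).1
    gcongr
    nlinarith
  · intro _ b c hb hbc hc
    refine (crossRatio_map_le_of_slope_le hb hbc hc (Real.exp_pos (K * (v - u))).le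
      (h' _ _ _ _ le_rfl hb (by linarith) le_rfl (by linarith) hc.le).2
      (h' _ _ _ _ (by linarith) hc le_rfl hb.le (by linarith) le_rfl).2
      (h' _ _ u v le_rfl (by linarith) hc.le le_rfl huv le_rfl).1
      (h' _ _ u v hb.le (by linarith) le_rfl le_rfl huv le_rfl).1
      (h' _ _ u v (by linarith) hc le_rfl le_rfl huv le_rfl).1.le).trans ?_
    rw [← Real.exp_add]
    have := (crossRatio_pos hb hbc hc).le
    gcongr
    have h3 : 0 ≤ K * (2 * r) * (v - u) := mul_nonneg (by positivity) (by linarith)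
    nlinarith

/-- Near a non-flat critical point of an increasing map the diffeomorphism `φ` is increasing. -/
lemma IsNonFlatCritPt.exists_chart {f : ℝ → ℝ} {c d : ℝ} (h : IsNonFlatCritPt f c d)
    (hf : StrictMono f) :
    ∃ φ : ℝ → ℝ, ContDiffAt ℝ 2 φ c ∧ 0 < deriv φ c ∧ φ c = 0 ∧
      ∃ r > 0, ∀ x, |x - c| < r → f x = f c + oddPow d (φ x) := by
  obtain ⟨hd, W, φ, hW, hcW, hφ, h0, hder, -, hfφ⟩ := h
  obtain ⟨r, hr, hball⟩ := Metric.isOpen_iff.1 hW c hcW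
  have hin : ∀ x, |x - c| < r → x ∈ W := fun x hx => hball (by rwa [Metric.mem_ball, Real.dist_eq])
  have hform : ∀ x, |x - c| < r → f x = f c + oddPow d (φ x) := fun x hx => hfφ x (hin x hx)
  refine ⟨φ, (hφ.contDiffAt (hW.mem_nhds hcW)).of_le (by norm_num), ?_, h0, r, hr, hform⟩
  refine lt_of_le_of_ne ?_ (hder c hcW).symm
  have hmono : MonotoneOn φ (Metric.ball c r) := by
    intro x hx y hy hxy
    rw [Metric.mem_ball, Real.dist_eq] at hx hy
    have h1 := hf.monotone hxy
    rw [hform x hx, hform y hy] at h1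
    exact (oddPow_strictMono (zero_lt_one.trans hd)).le_iff_le.1 (by linarith)
  have := hmono.derivWithin_nonneg (x := c)
  rwa [derivWithin_of_mem_nhds (Metric.ball_mem_nhds c hr)] at this

lemma chart_pos_or_neg {f φ : ℝ → ℝ} {u v c d : ℝ} (hf : StrictMono f)
    (h : ∀ t ∈ Icc u v, deriv f t ≠ 0) (hc : deriv f c = 0) (hd : 0 < d)
    (hform : ∀ x ∈ Icc u v, f x = f c + oddPow d (φ x)) (huv : u ≤ v) :
    0 < φ u ∨ φ v < 0 := by
  have e : oddPow d 0 = 0 := by simp [oddPow]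
  have hcn : c ∉ Icc u v := fun hmem => h c hmem hc
  rw [mem_Icc, not_and_or, not_le, not_le] at hcn
  rw [← (oddPow_strictMono hd).lt_iff_lt (a := 0), ← (oddPow_strictMono hd).lt_iff_lt (b := 0), e]
  rcases hcn with hcu | hvc
  · have := hf hcu
    rw [hform u ⟨le_rfl, huv⟩] at this
    left; linarith
  · have := hf hvc
    rw [hform v ⟨huv, le_rfl⟩] at this
    right; linarith

lemma slope_chart {f φ : ℝ → ℝ} {a b k d : ℝ} (ha : f a = k + oddPow d (φ a))
    (hb : f b = k + oddPow d (φ b)) (hab : φ a < φ b) :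
    slope f a b = slope (oddPow d) (φ a) (φ b) * slope φ a b := by
  simp only [slope_def_field, ha, hb]
  have := (sub_pos.2 hab).ne'
  field_simp
  ring

lemma smallScaleDistortion_of_isNonFlatCritPt {f : ℝ → ℝ} {c d : ℝ} (h : IsNonFlatCritPt f c d)
    (hf : StrictMono f) (hc : deriv f c = 0) : ∃ S ∈ 𝓝 c, SmallScaleDistortion f S := by
  obtain ⟨φ, hφ, hφd, -, r₂, hr₂, hform⟩ := h.exists_chart hf
  obtain ⟨hd, -⟩ := h
  have hd0 : 0 < d := by linarith
  obtain ⟨r₁, hr₁, K, hK, hsl⟩ := exists_slope_le_exp_mul_slope hφ hφd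
  set r := min r₁ r₂ with hr_def
  have hr : 0 < r := lt_min hr₁ hr₂
  have hrr₁ : r ≤ r₁ := min_le_left _ _
  have hrr₂ : r ≤ r₂ := min_le_right _ _
  refine ⟨Metric.ball c (r / 2), Metric.ball_mem_nhds _ (by positivity), r / 2, by positivity,
    2 * d + K * (2 * r) + 2 * K, by positivity, ?_⟩
  intro x hx u v hu huv hv
  rw [Metric.mem_ball, Real.dist_eq, abs_lt] at hx
  have h' := hsl u v (by linarith) (by linarith)
  have hfm : ∀ y ∈ Icc u v, f y = f c + oddPow d (φ y) := by
    intro y hy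
    refine hform y ?_
    rw [abs_lt]
    constructor <;> linarith [hy.1, hy.2]
  have hφm : ∀ a b, u ≤ a → a < b → b ≤ v → φ a < φ b := by
    intro a b ha hab hb
    have := (h' a b a b ha hab hb ha hab hb).1
    rw [slope_def_field, div_pos_iff_of_pos_right (by linarith)] at this
    linarith
  have hφm' : ∀ a b, u ≤ a → a ≤ b → b ≤ v → φ a ≤ φ b := by
    intro a b ha hab hb
    rcases hab.eq_or_lt with rfl | hab
    · exact le_rfl
    · exact (hφm a b ha hab hb).le
  refine ⟨?_, ?_⟩
  · intro a b ha hab hb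
    have hφab := hφm a b ha hab hb
    rw [slope_chart (hfm a ⟨ha, by linarith⟩) (hfm b ⟨by linarith, hb⟩) hφab,
      slope_chart (hfm u ⟨le_rfl, huv.le⟩) (hfm v ⟨huv.le, le_rfl⟩) (hφm u v le_rfl huv le_rfl)]
    obtain ⟨p1, q1⟩ := h' a b u v ha hab hb le_rfl huv le_rfl
    have q2 := slope_oddPow_le hd hφab
    have q3 := le_slope_oddPow hd (hφm u v le_rfl huv le_rfl)
    have hM : max |φ a| |φ b| ≤ max |φ u| |φ v| := by
      have h1 := hφm' u a le_rfl ha (by linarith)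
      have h2 := hφm' b v (by linarith) hb le_rfl
      apply max_le
      · exact abs_le_max_abs_abs h1 (hφab.le.trans h2)
      · exact abs_le_max_abs_abs (h1.trans hφab.le) h2
    set m := max |φ a| |φ b|
    set M := max |φ u| |φ v|
    have hm0 : 0 ≤ m := le_max_of_le_left (abs_nonneg _)
    have hmM : m ^ (d - 1) ≤ M ^ (d - 1) := Real.rpow_le_rpow hm0 hM (by linarith)
    have hSl : 0 ≤ slope φ u v := (h' u v u v le_rfl huv le_rfl le_rfl huv le_rfl).1.le
    have hS0 : 0 ≤ slope (oddPow d) (φ u) (φ v) := by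
      refine le_trans ?_ q3
      have : 0 ≤ M := hm0.trans hM
      positivity
    have q4 : slope (oddPow d) (φ a) (φ b) ≤ 2 * d * slope (oddPow d) (φ u) (φ v) := by
      nlinarith
    have q5 : 2 * d ≤ Real.exp (2 * d) := by linarith [Real.add_one_le_exp (2 * d)]
    calc slope (oddPow d) (φ a) (φ b) * slope φ a b
        ≤ (2 * d * slope (oddPow d) (φ u) (φ v)) * (Real.exp (K * (v - u)) * slope φ u v) :=
          mul_le_mul q4 q1 p1.le (by positivity)
      _ ≤ (Real.exp (2 * d) * slope (oddPow d) (φ u) (φ v)) *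
            (Real.exp (K * (2 * r) + 2 * K) * slope φ u v) := by
          gcongr
          nlinarith
      _ = _ := by rw [add_assoc, Real.exp_add (2 * d)]; ring
  · intro hcrit b e hb hbe he
    rw [hfm u ⟨le_rfl, huv.le⟩, hfm v ⟨huv.le, le_rfl⟩, hfm b ⟨hb.le, by linarith⟩,
      hfm e ⟨by linarith, he.le⟩]
    simp only [add_comm (f c)]
    rw [crossRatio_add_const]
    refine (crossRatio_oddPow_le hd.le (hφm u b le_rfl hb (by linarith))
      (hφm b e hb.le hbe he.le) (hφm e v (by linarith) he le_rfl)
      (chart_pos_or_neg hf hcrit hc hd0 hfm huv.le)).trans ?_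
    refine (crossRatio_map_le_of_slope_le hb hbe he (Real.exp_pos (K * (v - u))).le
      (h' _ _ _ _ le_rfl hb (by linarith) le_rfl (by linarith) he.le).2
      (h' _ _ _ _ (by linarith) he le_rfl hb.le (by linarith) le_rfl).2
      (h' _ _ u v le_rfl (by linarith) he.le le_rfl huv le_rfl).1
      (h' _ _ u v hb.le (by linarith) le_rfl le_rfl huv le_rfl).1
      (h' _ _ u v (by linarith) he le_rfl le_rfl huv le_rfl).1.le).trans ?_
    rw [← Real.exp_add]
    have := (crossRatio_pos hb hbe he).le
    gcongr
    have h3 : 0 ≤ (2 * d + K * (2 * r)) * (v - u) := mul_nonneg (by positivity) (by linarith)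
    nlinarith

/-! ### Uniform distortion control for a multicritical circle map -/

lemma IsCircleMapLift.map_add_int {f : ℝ → ℝ} (hf : IsCircleMapLift f) (x : ℝ) (k : ℤ) :
    f (x + k) = f x + k :=
  CircleDeg1Lift.map_add_int ⟨⟨f, hf.mono.monotone⟩, hf.periodic⟩ x k

lemma IsCircleMapLift.deriv_add_int {f : ℝ → ℝ} (hf : IsCircleMapLift f) (x : ℝ) (k : ℤ) :
    deriv f (x + k) = deriv f x := by
  rw [← deriv_comp_add_const]
  simp only [hf.map_add_int, deriv_add_const]

lemma IsCircleMapLift.slope_add_int {f : ℝ → ℝ} (hf : IsCircleMapLift f) (a b : ℝ) (k : ℤ) :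
    slope f (a + k) (b + k) = slope f a b := by
  simp [slope_def_field, hf.map_add_int]

lemma exists_forall_le_of_periodic {g : ℝ → ℝ} (hg : Continuous g)
    (hp : Function.Periodic g 1) : ∃ z, ∀ x, g z ≤ g x := by
  obtain ⟨z, -, hz⟩ := (isCompact_Icc (a := (0 : ℝ)) (b := 1)).exists_isMinOn
    ⟨0, by simp⟩ hg.continuousOn
  refine ⟨z, fun x => ?_⟩
  obtain ⟨y, hy, e⟩ := hp.exists_mem_Ico₀ zero_lt_one x
  rw [e]
  exact hz ⟨hy.1, hy.2.le⟩

lemma SmallScaleDistortion.of_int_translates {f : ℝ → ℝ} {S : Set ℝ} (hf : IsCircleMapLift f)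
    (h : SmallScaleDistortion f S) : SmallScaleDistortion f {x | ∃ k : ℤ, x + k ∈ S} := by
  obtain ⟨η, hη, K, hK, h⟩ := h
  refine ⟨η, hη, K, hK, ?_⟩
  rintro x ⟨k, hk⟩ u v hu huv hv
  obtain ⟨h1, h2⟩ := h (x + k) hk (u + k) (v + k) (by linarith) (by linarith) (by linarith)
  refine ⟨fun a b ha hab hb => ?_, fun hc b c hb hbc hcv => ?_⟩
  · have := h1 (a + k) (b + k) (by linarith) (by linarith) (by linarith)
    rwa [hf.slope_add_int, hf.slope_add_int] at this
  · have := h2 (fun t ht => ?_) (b + k) (c + k) (by linarith) (by linarith) (by linarith)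
    · simp only [hf.map_add_int, crossRatio_add_const, add_sub_add_right_eq_sub] at this
      exact this
    · have := hc (t - k) ⟨by linarith [ht.1], by linarith [ht.2]⟩
      rwa [← hf.deriv_add_int _ k, sub_add_cancel] at this

lemma SmallScaleDistortion.union {f : ℝ → ℝ} {S T : Set ℝ} (hf : StrictMono f)
    (hS : SmallScaleDistortion f S) (hT : SmallScaleDistortion f T) :
    SmallScaleDistortion f (S ∪ T) := by
  have mono : ∀ {K K' u v : ℝ} {η : ℝ}, K ≤ K' → u < v →
      ((∀ a b : ℝ, u ≤ a → a < b → b ≤ v → slope f a b ≤ Real.exp K * slope f u v) ∧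
      ((∀ t ∈ Icc u v, deriv f t ≠ 0) → ∀ b c : ℝ, u < b → b < c → c < v →
        crossRatio (f u) (f b) (f c) (f v) ≤ Real.exp (K * (v - u)) * crossRatio u b c v)) →
      ((∀ a b : ℝ, u ≤ a → a < b → b ≤ v → slope f a b ≤ Real.exp K' * slope f u v) ∧
      ((∀ t ∈ Icc u v, deriv f t ≠ 0) → ∀ b c : ℝ, u < b → b < c → c < v →
        crossRatio (f u) (f b) (f c) (f v) ≤ Real.exp (K' * (v - u)) * crossRatio u b c v)) := by
    intro K K' u v η hKK huv h
    refine ⟨fun a b ha hab hb => (h.1 a b ha hab hb).trans ?_,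
      fun hc b c hb hbc hcv => (h.2 hc b c hb hbc hcv).trans ?_⟩
    · have := (slope_pos_of_strictMono huv (hf huv)).le
      gcongr
    · have := (crossRatio_pos hb hbc hcv).le
      have : 0 ≤ v - u := by linarith
      gcongr
  obtain ⟨η₁, hη₁, K₁, hK₁, h₁⟩ := hS
  obtain ⟨η₂, hη₂, K₂, hK₂, h₂⟩ := hT
  refine ⟨min η₁ η₂, lt_min hη₁ hη₂, max K₁ K₂, le_max_of_le_left hK₁, ?_⟩
  intro x hx u v hu huv hv
  have l1 := min_le_left η₁ η₂
  have l2 := min_le_right η₁ η₂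
  rcases hx with hx | hx
  · exact mono (η := η₁) (le_max_left _ _) huv (h₁ x hx u v (by linarith) huv (by linarith))
  · exact mono (η := η₁) (le_max_right _ _) huv (h₂ x hx u v (by linarith) huv (by linarith))

lemma IsMulticriticalLift.smallScaleDistortion {f : ℝ → ℝ} {C : Finset ℝ} {dc : ℝ → ℝ}
    (hf : IsMulticriticalLift f C dc) : SmallScaleDistortion f univ := by
  obtain ⟨hl, -, -, hcrit, hflat⟩ := hf
  have hI : SmallScaleDistortion f (Icc 0 1) := by
    refine isCompact_Icc.induction_on ⟨1, one_pos, 0, le_rfl, by simp⟩ ?_ ?_ ?_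
    · rintro s t hst ⟨η, hη, K, hK, h⟩
      exact ⟨η, hη, K, hK, fun x hx => h x (hst hx)⟩
    · intro s t hs ht
      exact hs.union hl.mono ht
    · intro x _
      by_cases hx : deriv f x = 0
      · obtain ⟨c, hc, k, rfl⟩ := (hcrit x).1 hx
        have hc0 : deriv f c = 0 := by rw [← hx, hl.deriv_add_int]
        obtain ⟨S, hS, h⟩ := smallScaleDistortion_of_isNonFlatCritPt (hflat c hc) hl.mono hc0
        refine ⟨_, mem_nhdsWithin_of_mem_nhds ?_, h.of_int_translates hl⟩
        have hcont : ContinuousAt (fun y : ℝ => y + ((-k : ℤ) : ℝ)) (c + k) := by fun_prop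
        have : S ∈ 𝓝 ((c + k) + ((-k : ℤ) : ℝ)) := by
          rwa [Int.cast_neg, add_neg_cancel_right]
        filter_upwards [hcont.preimage_mem_nhds this] with y hy
        exact ⟨-k, hy⟩
      · have hx' : 0 < deriv f x := lt_of_le_of_ne (hl.mono.monotone.deriv_nonneg) (Ne.symm hx)
        obtain ⟨S, hS, h⟩ := smallScaleDistortion_of_deriv_pos hl.smooth hx'
        exact ⟨S, mem_nhdsWithin_of_mem_nhds hS, h⟩
  have hu : {x : ℝ | ∃ k : ℤ, x + k ∈ Icc (0 : ℝ) 1} = univ :=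
    eq_univ_of_forall fun x => ⟨-⌊x⌋, by
      rw [Int.cast_neg, ← sub_eq_add_neg]
      exact ⟨by linarith [Int.floor_le x], by linarith [Int.lt_floor_add_one x]⟩⟩
  rw [← hu]
  exact hI.of_int_translates hl

lemma IsMulticriticalLift.exists_slope_le {f : ℝ → ℝ} {C : Finset ℝ} {dc : ℝ → ℝ}
    (hf : IsMulticriticalLift f C dc) :
    ∃ E > 0, ∀ u v a b : ℝ, u ≤ a → a < b → b ≤ v → v ≤ u + 5 →
      slope f a b ≤ E * slope f u v := by
  obtain ⟨η₀, hη₀, K, hK, h⟩ := hf.smallScaleDistortion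
  have hl := hf.1
  set η := min η₀ 1 with hηdef
  have hη : 0 < η := lt_min hη₀ one_pos
  have hη1 : η ≤ 1 := min_le_right _ _
  have hη0 : η ≤ η₀ := min_le_left _ _
  have hloc : ∀ u v a b : ℝ, u ≤ a → a < b → b ≤ v → v < u + η →
      slope f a b ≤ Real.exp K * slope f u v := fun u v a b ha hab hb hv =>
    (h u (mem_univ _) u v (by linarith) (by linarith) (by linarith)).1 a b ha hab hb
  obtain ⟨z, hz⟩ := exists_forall_le_of_periodic (g := fun x => f (x + η / 2) - f x)
    (by have := hl.smooth.continuous; fun_prop)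
    (fun x => by
      have e : x + 1 + η / 2 = x + η / 2 + 1 := by ring
      simp only [e, hl.periodic, add_sub_add_right_eq_sub])
  set κ := f (z + η / 2) - f z with hκ
  have hκ0 : 0 < κ := sub_pos.2 (hl.mono (by linarith))
  have hup : ∀ x y, y ≤ x + 5 → f y - f x ≤ 5 := by
    intro x y hxy
    have h1 := hl.mono.monotone hxy
    have h2 := hl.map_add_int x 5
    push_cast at h2
    linarith
  have hE1 : 1 ≤ Real.exp K := Real.one_le_exp hK
  refine ⟨Real.exp K * (1 + 50 / (η * κ)), by positivity, ?_⟩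
  intro u v a b ha hab hb hv
  have hpos := slope_pos_of_strictMono (ha.trans_lt hab |>.trans_le hb)
    (hl.mono (ha.trans_lt hab |>.trans_le hb))
  rcases lt_or_ge v (u + η) with hv' | hv'
  · refine (hloc u v a b ha hab hb hv').trans ?_
    have : 0 ≤ 50 / (η * κ) := by positivity
    gcongr
    nlinarith
  · have h1 : slope f a b ≤ Real.exp K * (10 / η) := by
      rcases lt_or_ge b (a + η / 2) with hb' | hb'
      · refine (hloc a (a + η / 2) a b le_rfl hab hb'.le (by linarith)).trans ?_
        gcongr
        rw [slope_def_field, div_le_div_iff₀ (by linarith) hη]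
        have := hup a (a + η / 2) (by linarith)
        nlinarith
      · have h2 : slope f a b ≤ 10 / η := by
          rw [slope_def_field, div_le_div_iff₀ (by linarith) hη]
          have := hup a b (by linarith)
          nlinarith
        have : 0 < 10 / η := by positivity
        nlinarith
    have h2 : κ / 5 ≤ slope f u v := by
      rw [slope_def_field, div_le_div_iff₀ (by norm_num) (by linarith)]
      have h3 := hz u
      have h4 := hl.mono.monotone (show u + η / 2 ≤ v by linarith)
      nlinarith
    calc slope f a b ≤ Real.exp K * (10 / η) := h1
      _ = Real.exp K * (50 / (η * κ)) * (κ / 5) := by field_simp; ring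
      _ ≤ Real.exp K * (1 + 50 / (η * κ)) * slope f u v := by
        gcongr
        linarith

/-- Cross-ratio distortion of `f` is bounded on every interval, and close to `1` on short
intervals without critical points. -/
lemma IsMulticriticalLift.exists_crossRatio_map_le {f : ℝ → ℝ} {C : Finset ℝ} {dc : ℝ → ℝ}
    (hf : IsMulticriticalLift f C dc) :
    ∃ K ≥ 0, ∀ a b c d : ℝ, a < b → b < c → c < d → d ≤ a + 5 →
      crossRatio (f a) (f b) (f c) (f d) ≤ Real.exp K * crossRatio a b c d ∧
      ((∀ t ∈ Icc a d, deriv f t ≠ 0) →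
        crossRatio (f a) (f b) (f c) (f d) ≤ Real.exp (K * (d - a)) * crossRatio a b c d) := by
  obtain ⟨E, hE, hsl⟩ := hf.exists_slope_le
  obtain ⟨η, hη, K, hK, h⟩ := hf.smallScaleDistortion
  have hmono := hf.1.mono
  refine ⟨K + E * E + E * E / η, by positivity, ?_⟩
  intro a b c d hab hbc hcd hd
  have hcr := (crossRatio_pos hab hbc hcd).le
  have h1 : crossRatio (f a) (f b) (f c) (f d) ≤ E * E * crossRatio a b c d :=
    crossRatio_map_le_of_slope_le hab hbc hcd hE.le
      (hsl _ _ _ _ le_rfl hab hbc.le (by linarith)) (hsl _ _ _ _ hbc.le hcd le_rfl (by linarith))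
      (slope_pos_of_strictMono (hab.trans hbc) (hmono (hab.trans hbc)))
      (slope_pos_of_strictMono (hbc.trans hcd) (hmono (hbc.trans hcd)))
      (slope_pos_of_strictMono hcd (hmono hcd)).le
  have hq : 0 ≤ E * E / η := by positivity
  refine ⟨h1.trans ?_, fun hc => ?_⟩
  · gcongr
    linarith [Real.add_one_le_exp (K + E * E + E * E / η)]
  · rcases lt_or_ge d (a + η) with hd' | hd'
    · refine ((h a (mem_univ _) a d (by linarith) (by linarith) hd').2 hc b c hab hbc hcd).trans ?_
      have : 0 ≤ d - a := by linarith
      gcongr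
      nlinarith
    · refine h1.trans ?_
      gcongr
      have h2 : E * E / η * η ≤ E * E / η * (d - a) := by gcongr; linarith
      rw [div_mul_cancel₀ _ hη.ne'] at h2
      have h3 : 0 ≤ (K + E * E) * (d - a) := mul_nonneg (by positivity) (by linarith)
      have := Real.add_one_le_exp ((K + E * E + E * E / η) * (d - a))
      nlinarith

/-- The power law at a critical point, in scale-invariant form. -/
lemma IsMulticriticalLift.exists_power_law {f : ℝ → ℝ} {C : Finset ℝ} {dc : ℝ → ℝ}
    (hf : IsMulticriticalLift f C dc) {c : ℝ} (hc : c ∈ C) :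
    ∃ K > 0, ∀ x y : ℝ, |x - c| ≤ 5 → |y - c| ≤ 5 →
      |f x - f c| * |y - c| ^ dc c ≤ K * (|x - c| ^ dc c * |f y - f c|) := by
  obtain ⟨hl, -, -, -, hflat⟩ := hf
  obtain ⟨φ, hφ, hφd, hφ0, r₂, hr₂, hform⟩ := (hflat c hc).exists_chart hl.mono
  have hd : 1 < dc c := (hflat c hc).1
  set d := dc c
  have hd0 : 0 < d := by linarith
  have hder : HasDerivAt φ (deriv φ c) c := (hφ.differentiableAt (by norm_num)).hasDerivAt
  set D := deriv φ c
  have hev := hder.isLittleO.def (show 0 < D / 2 by positivity)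
  obtain ⟨r₁, hr₁, hball⟩ := Metric.eventually_nhds_iff_ball.1 hev
  set r := min (min r₁ r₂) 5 / 2 with hrdef
  have hr : 0 < r := by positivity
  have hrr₁ : r < r₁ := by
    have := (min_le_left (min r₁ r₂) 5).trans (min_le_left _ _); linarith
  have hrr₂ : r < r₂ := by
    have := (min_le_left (min r₁ r₂) 5).trans (min_le_right _ _); linarith
  have hr5 : r ≤ 5 := by
    have := min_le_right (min r₁ r₂) 5; linarith
  have hnear : ∀ x, |x - c| ≤ r → (D / 2) ^ d * |x - c| ^ d ≤ |f x - f c| ∧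
      |f x - f c| ≤ (2 * D) ^ d * |x - c| ^ d := by
    intro x hx
    have h1 := hball x (by rw [Metric.mem_ball, Real.dist_eq]; linarith)
    simp only [hφ0, sub_zero, smul_eq_mul, Real.norm_eq_abs] at h1
    have h2 : |f x - f c| = |φ x| ^ d := by
      rw [hform x (by linarith), add_sub_cancel_left, abs_oddPow hd0]
    have h3 : |(x - c) * D| = |x - c| * D := by rw [abs_mul, abs_of_pos hφd]
    have h4 := abs_sub_abs_le_abs_sub (φ x) ((x - c) * D)
    have h5 := abs_sub_abs_le_abs_sub ((x - c) * D) (φ x)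
    rw [abs_sub_comm] at h5
    rw [h2, ← Real.mul_rpow (by positivity) (abs_nonneg _),
      ← Real.mul_rpow (by positivity) (abs_nonneg _)]
    have h6 : 0 ≤ D * |x - c| := by positivity
    constructor
    · apply Real.rpow_le_rpow (by positivity) _ hd0.le
      linarith
    · apply Real.rpow_le_rpow (abs_nonneg _) _ hd0.le
      linarith
  have hfar : ∀ x, r ≤ |x - c| → |x - c| ≤ 5 → (D / 2) ^ d * r ^ d ≤ |f x - f c| ∧
      |f x - f c| ≤ 5 := by
    intro x hx hx5
    constructor
    · rcases le_total c x with hcx | hcx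
      · rw [abs_of_nonneg (sub_nonneg.2 hcx)] at hx hx5
        have h1 := (hnear (c + r) (by rw [add_sub_cancel_left, abs_of_pos hr])).1
        rw [add_sub_cancel_left, abs_of_pos hr,
          abs_of_pos (sub_pos.2 (hl.mono (by linarith : c < c + r)))] at h1
        rw [abs_of_nonneg (sub_nonneg.2 (hl.mono.monotone hcx))]
        linarith [hl.mono.monotone (by linarith : c + r ≤ x)]
      · rw [abs_of_nonpos (sub_nonpos.2 hcx)] at hx hx5
        have h1 := (hnear (c - r) (by rw [sub_sub_cancel_left, abs_neg, abs_of_pos hr])).1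
        rw [sub_sub_cancel_left, abs_neg, abs_of_pos hr,
          abs_of_neg (sub_neg.2 (hl.mono (by linarith : c - r < c)))] at h1
        rw [abs_of_nonpos (sub_nonpos.2 (hl.mono.monotone hcx))]
        linarith [hl.mono.monotone (by linarith : x ≤ c - r)]
    · have h1 := hl.mono.monotone (show x ≤ c + 5 by linarith [(abs_le.1 hx5).2])
      have h2 := hl.mono.monotone (show c - 5 ≤ x by linarith [(abs_le.1 hx5).1])
      have h3 := hl.map_add_int c 5
      have h4 := hl.map_add_int (c - 5) 5
      push_cast at h3 h4
      rw [sub_add_cancel] at h4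
      rw [abs_le]
      constructor <;> linarith
  obtain ⟨k₁, hk₁, hlow⟩ : ∃ k > 0, ∀ y, |y - c| ≤ 5 → k * |y - c| ^ d ≤ |f y - f c| := by
    refine ⟨(D / 2) ^ d * (r / 5) ^ d, by positivity, fun y hy => ?_⟩
    have h5 : (r / 5) ^ d ≤ 1 := Real.rpow_le_one (by positivity) (by linarith) hd0.le
    rcases le_total |y - c| r with h | h
    · refine le_trans ?_ (hnear y h).1
      have : 0 ≤ |y - c| ^ d := by positivity
      have : 0 ≤ (D / 2) ^ d := by positivity
      gcongr
      nlinarith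
    · refine le_trans ?_ (hfar y h hy).1
      rw [mul_assoc, ← Real.mul_rpow (by positivity) (by positivity)]
      gcongr
      nlinarith [abs_nonneg (y - c)]
  obtain ⟨k₂, hk₂, hupp⟩ : ∃ k > 0, ∀ y, |y - c| ≤ 5 → |f y - f c| ≤ k * |y - c| ^ d := by
    refine ⟨(2 * D) ^ d + 5 / r ^ d, by positivity, fun y hy => ?_⟩
    rcases le_total |y - c| r with h | h
    · refine (hnear y h).2.trans ?_
      gcongr
      have : 0 ≤ 5 / r ^ d := by positivity
      linarith
    · refine (hfar y h hy).2.trans ?_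
      have h1 : r ^ d ≤ |y - c| ^ d := by gcongr
      have h2 : 5 = 5 / r ^ d * r ^ d := by field_simp
      calc (5 : ℝ) = 5 / r ^ d * r ^ d := h2
        _ ≤ _ := by
          gcongr
          have : 0 ≤ (2 * D) ^ d := by positivity
          linarith
  refine ⟨k₂ / k₁, by positivity, fun x y hx hy => ?_⟩
  have h1 := hupp x hx
  have h2 := hlow y hy
  have h3 : |y - c| ^ d ≤ |f y - f c| / k₁ := by rw [le_div_iff₀ hk₁]; linarith
  calc |f x - f c| * |y - c| ^ d ≤ (k₂ * |x - c| ^ d) * (|f y - f c| / k₁) := by gcongr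
    _ = _ := by ring

/-! ### The two-generator action of a lift and of the unit translation -/

/-- The lift `x ↦ e^q x - p` of the `q`-th iterate of a circle homeomorphism. -/
def orb (e : ℝ ≃o ℝ) (q p : ℤ) (x : ℝ) : ℝ := (e ^ q) x - p

/-- The orbits of `e` on the circle are ordered as those of the rotation by `ρ`. -/
structure OrderedAsRotation (e : ℝ ≃o ℝ) (ρ : ℝ) : Prop where
  map_add_one : ∀ x, e (x + 1) = e x + 1
  irrational : Irrational ρ
  lt_orb : ∀ q p : ℤ, 0 < q * ρ - p → ∀ x, x < orb e q p x

namespace OrderedAsRotation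

variable {e : ℝ ≃o ℝ} {ρ : ℝ}

lemma zpow_add_int (h : OrderedAsRotation e ρ) (q k : ℤ) (x : ℝ) :
    (e ^ q) (x + k) = (e ^ q) x + k := by
  have he : ∀ (k : ℤ) x, e (x + k) = e x + k := fun k x =>
    CircleDeg1Lift.map_add_int ⟨⟨e, e.monotone⟩, h.map_add_one⟩ x k
  induction q with
  | zero => simp
  | succ n ih => rw [add_comm, zpow_add, zpow_one, RelIso.mul_apply, RelIso.mul_apply, ih, he]
  | pred n ih =>
    apply e.injective
    have key : ∀ y, e ((e ^ (-(n : ℤ) - 1)) y) = (e ^ (-(n : ℤ))) y := fun y => by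
      rw [← RelIso.mul_apply, ← zpow_one_add]; congr 2; ring
    rw [he, key, key, ih]

lemma orb_orb (h : OrderedAsRotation e ρ) (q p q' p' : ℤ) (x : ℝ) :
    orb e q p (orb e q' p' x) = orb e (q + q') (p + p') x := by
  have := h.zpow_add_int q (-p') ((e ^ q') x)
  simp only [orb, sub_eq_add_neg] at this ⊢
  push_cast at this ⊢
  rw [this, zpow_add, RelIso.mul_apply]
  ring

lemma orb_add_int (h : OrderedAsRotation e ρ) (q p k : ℤ) (x : ℝ) :
    orb e q p (x + k) = orb e q p x + k := by
  simp only [orb, h.zpow_add_int]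
  ring

end OrderedAsRotation

lemma orb_zero_zero (e : ℝ ≃o ℝ) (x : ℝ) : orb e 0 0 x = x := by simp [orb]

lemma orb_one_zero (e : ℝ ≃o ℝ) (x : ℝ) : orb e 1 0 x = e x := by simp [orb]

lemma orb_strictMono (e : ℝ ≃o ℝ) (q p : ℤ) : StrictMono (orb e q p) := fun x y hxy => by
  have := (e ^ q).strictMono hxy
  simp only [orb]
  linarith

lemma orb_continuous (e : ℝ ≃o ℝ) (q p : ℤ) : Continuous (orb e q p) :=
  (e ^ q).continuous.sub continuous_const

namespace OrderedAsRotation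

variable {e : ℝ ≃o ℝ} {ρ : ℝ}

lemma orb_lt_orb (h : OrderedAsRotation e ρ) {q p q' p' : ℤ} (hlt : q * ρ - p < q' * ρ - p')
    (x : ℝ) : orb e q p x < orb e q' p' x := by
  have := h.lt_orb (q' - q) (p' - p) (by push_cast; linarith) (orb e q p x)
  rwa [h.orb_orb, sub_add_cancel, sub_add_cancel] at this

lemma eq_of_linear_eq (h : OrderedAsRotation e ρ) {q p q' p' : ℤ}
    (heq : q * ρ - p = q' * ρ - p') : q = q' ∧ p = p' := by
  by_cases hq : q = q'
  · subst hq
    exact ⟨rfl, by exact_mod_cast (sub_right_inj.1 heq)⟩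
  · have h1 : ((q - q' : ℤ) : ℝ) ≠ 0 := by exact_mod_cast sub_ne_zero.2 hq
    refine absurd ?_ (((h.irrational.intCast_mul (sub_ne_zero.2 hq))).ne_int (p - p'))
    push_cast
    linarith

lemma orb_le_orb (h : OrderedAsRotation e ρ) {q p q' p' : ℤ} (hle : q * ρ - p ≤ q' * ρ - p')
    (x : ℝ) : orb e q p x ≤ orb e q' p' x := by
  rcases hle.lt_or_eq with hlt | heq
  · exact (h.orb_lt_orb hlt x).le
  · obtain ⟨rfl, rfl⟩ := h.eq_of_linear_eq heq
    exact le_rfl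

lemma lt_of_orb_lt_orb (h : OrderedAsRotation e ρ) {q p q' p' : ℤ} {x : ℝ}
    (hlt : orb e q p x < orb e q' p' x) : q * ρ - p < q' * ρ - p' := by
  by_contra! hle
  exact absurd (h.orb_le_orb hle x) (not_le.2 hlt)

end OrderedAsRotation

/-- The conjugate of `e` by the reflection `x ↦ -x`. -/
def mirror (e : ℝ ≃o ℝ) : ℝ ≃o ℝ where
  toFun x := -e (-x)
  invFun x := -e.symm (-x)
  left_inv x := by simp
  right_inv x := by simp
  map_rel_iff' := by simp

lemma mirror_apply (e : ℝ ≃o ℝ) (x : ℝ) : mirror e x = -e (-x) := rfl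

lemma mirror_zpow_apply (e : ℝ ≃o ℝ) (q : ℤ) (x : ℝ) : (mirror e ^ q) x = -(e ^ q) (-x) := by
  induction q generalizing x with
  | zero => simp
  | succ n ih =>
    rw [add_comm, zpow_add, zpow_add, zpow_one, zpow_one, RelIso.mul_apply, RelIso.mul_apply, ih,
      mirror_apply, neg_neg]
  | pred n ih =>
    apply (mirror e).injective
    have key : ∀ (e : ℝ ≃o ℝ) y, e ((e ^ (-(n : ℤ) - 1)) y) = (e ^ (-(n : ℤ))) y :=
      fun e y => by rw [← RelIso.mul_apply, ← zpow_one_add]; congr 2; ring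
    rw [key, mirror_apply, neg_neg, key, ih]

lemma orb_mirror (e : ℝ ≃o ℝ) (q p : ℤ) (x : ℝ) :
    orb (mirror e) q p x = -orb e q (-p) (-x) := by
  simp only [orb, mirror_zpow_apply]
  push_cast
  ring

lemma OrderedAsRotation.mirror {e : ℝ ≃o ℝ} {ρ : ℝ} (h : OrderedAsRotation e ρ) :
    OrderedAsRotation (mirror e) (-ρ) where
  map_add_one x := by
    have := h.map_add_one (-(x + 1))
    simp only [mirror_apply]
    rw [show -(x + 1) + 1 = -x by ring] at this
    linarith
  irrational := h.irrational.neg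
  lt_orb q p hpos x := by
    rw [orb_mirror]
    have := h.orb_lt_orb (q := q) (p := -p) (q' := 0) (p' := 0) (by push_cast; linarith) (-x)
    rw [orb_zero_zero] at this
    linarith

/-- A circle homeomorphism with irrational rotation number is ordered as a rotation. -/
lemma exists_orderedAsRotation {f : ℝ → ℝ} {ρ : ℝ} (hf : IsCircleMapLift f)
    (hρ : HasRotNumber f ρ) (hirr : Irrational ρ) :
    ∃ e : ℝ ≃o ℝ, (∀ x, e x = f x) ∧ OrderedAsRotation e ρ := by
  set F : CircleDeg1Lift := ⟨⟨f, hf.mono.monotone⟩, hf.periodic⟩ with hF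
  have hFf : ∀ x, F x = f x := fun x => rfl
  have hτ : CircleDeg1Lift.translationNumber F = ρ := by
    refine tendsto_nhds_unique (F.tendsto_translation_number₀) ?_
    refine hρ.congr fun n => ?_
    rw [CircleDeg1Lift.coe_pow]
    rfl
  have hsurj : Function.Surjective f :=
    hf.smooth.continuous.surjective F.tendsto_atTop F.tendsto_atBot
  refine ⟨hf.mono.orderIsoOfSurjective f hsurj, fun x => rfl, ?_⟩
  set e := hf.mono.orderIsoOfSurjective f hsurj
  have hef : ∀ x, e x = f x := fun x => rfl
  have hpow : ∀ (n : ℕ) x, (F ^ n) x = (e ^ (n : ℤ)) x := by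
    intro n
    induction n with
    | zero => intro x; simp
    | succ n ih =>
      intro x
      rw [pow_succ', CircleDeg1Lift.mul_apply, ih, Nat.cast_succ, add_comm, zpow_add, zpow_one,
        RelIso.mul_apply]
      rfl
  refine ⟨hf.periodic, hirr, fun q p hpos x => ?_⟩
  rcases le_total 0 q with hq | hq
  · obtain ⟨n, rfl⟩ := Int.eq_ofNat_of_zero_le hq
    have := CircleDeg1Lift.lt_map_of_int_lt_translationNumber (f := F ^ n) (n := p)
      (by rw [CircleDeg1Lift.translationNumber_pow, hτ]; push_cast at hpos; linarith) x
    rw [hpow] at this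
    simp only [orb]
    linarith
  · obtain ⟨n, hn⟩ := Int.eq_ofNat_of_zero_le (neg_nonneg.2 hq)
    obtain rfl : q = -(n : ℤ) := by omega
    have := CircleDeg1Lift.map_lt_of_translationNumber_lt_int (f := F ^ n) (n := -p)
      (by rw [CircleDeg1Lift.translationNumber_pow, hτ]; push_cast at hpos ⊢; linarith)
      ((e ^ (-(n : ℤ))) x)
    rw [hpow, ← RelIso.mul_apply, ← zpow_add, add_neg_cancel, zpow_zero, RelIso.one_apply] at this
    simp only [orb]
    push_cast at this
    linarith

/-! ### Consecutive convergents -/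

/-- Two consecutive convergents `p / q < ρ < p' / q'`. -/
structure Convergents (ρ : ℝ) (q p q' p' : ℤ) : Prop where
  pos : 0 < q * ρ - p
  neg : q' * ρ - p' < 0
  add_pos : 0 < (q * ρ - p) + (q' * ρ - p')
  lt_one : q * ρ - p < 1
  det : p' * q - p * q' = 1
  one_le : 1 ≤ q
  le : q ≤ q'

lemma Convergents.best_approx {ρ : ℝ} {q p q' p' : ℤ} (h : Convergents ρ q p q' p') {j k : ℤ}
    (hj : |j| < q') (hjk : j ≠ 0 ∨ k ≠ 0) : q * ρ - p ≤ |j * ρ - k| := by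
  obtain ⟨hpos, hneg, hadd, hlt, hdet, h1, hle⟩ := h
  set α := q * ρ - p with hα
  set β := q' * ρ - p' with hβ
  set u := j * p' - k * q' with hu
  set v := k * q - j * p with hv
  have hj' : j = u * q + v * q' := by
    calc j = j * (p' * q - p * q') := by rw [hdet, mul_one]
      _ = _ := by rw [hu, hv]; ring
  have hk' : k = u * p + v * p' := by
    calc k = k * (p' * q - p * q') := by rw [hdet, mul_one]
      _ = _ := by rw [hu, hv]; ring
  have hlin : j * ρ - k = u * α + v * β := by
    rw [hj', hk', hα, hβ]; push_cast; ring
  rw [hlin]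
  have hu0 : u ≠ 0 := by
    intro hu0
    rw [hu0, zero_mul, zero_add] at hj' hk'
    rcases eq_or_ne v 0 with hv0 | hv0
    · rw [hv0, zero_mul] at hj' hk'
      simp [hj', hk'] at hjk
    · have : 1 ≤ |v| := Int.one_le_abs hv0
      rw [hj', abs_mul, abs_of_pos (by omega : 0 < q')] at hj
      nlinarith
  rw [abs_lt] at hj
  rcases lt_or_gt_of_ne hu0 with hu0 | hu0
  · have hv0 : 0 ≤ v := by
      by_contra! hv0
      nlinarith
    have h2 : (u : ℝ) ≤ -1 := by exact_mod_cast (by omega : u ≤ -1)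
    have h3 : (0 : ℝ) ≤ v := by exact_mod_cast hv0
    rw [abs_of_neg (by nlinarith)]
    nlinarith
  · have hv0 : v ≤ 0 := by
      by_contra! hv0
      nlinarith
    have h2 : (1 : ℝ) ≤ u := by exact_mod_cast (by omega : 1 ≤ u)
    have h3 : (v : ℝ) ≤ 0 := by exact_mod_cast hv0
    rw [abs_of_pos (by nlinarith)]
    nlinarith

lemma Convergents.next {ρ : ℝ} {q p q' p' a : ℤ} (h : Convergents ρ q p q' p') (ha : 1 ≤ a)
    (hlow : 0 < (a * q' + q) * ρ - (a * p' + p))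
    (hupp : ((a + 1) * q' + q) * ρ - ((a + 1) * p' + p) < 0) :
    Convergents (-ρ) q' (-p') (a * q' + q) (-(a * p' + p)) := by
  obtain ⟨hpos, hneg, hadd, hlt, hdet, h1, hle⟩ := h
  refine ⟨?_, ?_, ?_, ?_, by linarith, by omega, by nlinarith⟩ <;> push_cast <;> linarith

lemma gaussMap_iterate_mem {ρ : ℝ} (hirr : Irrational ρ) (n : ℕ) :
    gaussMap^[n] (Int.fract ρ) ∈ Ioo (0 : ℝ) 1 ∧ Irrational (gaussMap^[n] (Int.fract ρ)) := by
  have key : ∀ x : ℝ, Irrational x → Int.fract x ∈ Ioo (0 : ℝ) 1 ∧ Irrational (Int.fract x) := by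
    intro x hx
    have hi : Irrational (Int.fract x) := by
      rw [Int.fract]; exact hx.sub_intCast _
    exact ⟨⟨lt_of_le_of_ne (Int.fract_nonneg x) hi.ne_zero.symm, Int.fract_lt_one x⟩, hi⟩
  induction n with
  | zero => exact key ρ hirr
  | succ n ih =>
    rw [Function.iterate_succ_apply']
    exact key _ ih.2.inv

lemma one_le_cfA {ρ : ℝ} (hirr : Irrational ρ) (n : ℕ) : 1 ≤ cfA ρ n := by
  obtain ⟨h0, h1⟩ := (gaussMap_iterate_mem hirr n).1
  exact Nat.one_le_floor_iff _ |>.2 (one_le_inv₀ h0 |>.2 h1.le)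

/-- The convergents at even depth lie below `ρ` and those at odd depth above it. -/
lemma convergents_qden_pnum {ρ : ℝ} (hirr : Irrational ρ) (h01 : ρ ∈ Ioo (0 : ℝ) 1) (n : ℕ) :
    Convergents (((-1) ^ n : ℤ) * ρ) (qden ρ n) ((-1) ^ n * pnum ρ n) (qden ρ (n + 1))
      ((-1) ^ n * pnum ρ (n + 1)) ∧
    -(((-1) ^ n : ℤ) * (qden ρ (n + 1) * ρ - pnum ρ (n + 1))) =
      gaussMap^[n + 1] (Int.fract ρ) * (((-1) ^ n : ℤ) * (qden ρ n * ρ - pnum ρ n)) := by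
  have hfr : Int.fract ρ = ρ := Int.fract_eq_self.2 ⟨h01.1.le, h01.2⟩
  have hfl : ∀ n, (cfA ρ n : ℝ) = (gaussMap^[n] (Int.fract ρ))⁻¹ -
      gaussMap^[n + 1] (Int.fract ρ) := fun n => by
    rw [Function.iterate_succ_apply', cfA, gaussMap,
      ← Int.self_sub_floor (gaussMap^[n] (Int.fract ρ))⁻¹, sub_sub_cancel,
      natCast_floor_eq_intCast_floor (inv_nonneg.2 (gaussMap_iterate_mem hirr n).1.1.le)]
  induction n with
  | zero =>
    have h := hfl 0
    have h1 := (gaussMap_iterate_mem hirr 1).1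
    simp only [Function.iterate_zero, Function.iterate_one, id_eq, zero_add, hfr] at h h1 ⊢
    have h2 : (cfA ρ 0 : ℝ) * ρ = 1 - gaussMap ρ * ρ := by
      rw [h, sub_mul, inv_mul_cancel₀ h01.1.ne']
    have h3 : 0 < gaussMap ρ * ρ := mul_pos h1.1 h01.1
    have h4 : gaussMap ρ * ρ < ρ := by nlinarith [h1.2, h01.1]
    have h5 : (1 : ℤ) ≤ cfA ρ 0 := by exact_mod_cast one_le_cfA hirr 0
    refine ⟨⟨?_, ?_, ?_, ?_, ?_, ?_, ?_⟩, ?_⟩ <;> simp [qden, pnum] <;>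
      linarith [h01.1, h01.2]
  | succ n ih =>
    obtain ⟨hc, he⟩ := ih
    have h := hfl (n + 1)
    have h1 := (gaussMap_iterate_mem hirr (n + 1)).1
    have h2 := (gaussMap_iterate_mem hirr (n + 2)).1
    set x := gaussMap^[n + 1] (Int.fract ρ)
    set x' := gaussMap^[n + 1 + 1] (Int.fract ρ)
    have hpos := hc.pos
    have hneg := hc.neg
    set s : ℤ := (-1) ^ n with hs
    have hs' : ((-1) ^ (n + 1) : ℤ) = -s := by rw [pow_succ]; ring
    rw [hs']
    have hq : (qden ρ (n + 1 + 1) : ℝ) = cfA ρ (n + 1) * qden ρ (n + 1) + qden ρ n := by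
      simp [qden]
    have hp : (pnum ρ (n + 1 + 1) : ℝ) = cfA ρ (n + 1) * pnum ρ (n + 1) + pnum ρ n := by
      simp [pnum]
    have hxa : x * cfA ρ (n + 1) = 1 - x * x' := by
      rw [h, mul_sub, mul_inv_cancel₀ h1.1.ne']
    push_cast at hpos hneg
    have hα : 0 < (s : ℝ) * (qden ρ n * ρ - pnum ρ n) := by linarith
    set α := (s : ℝ) * (qden ρ n * ρ - pnum ρ n) with hαd
    have hβ : (s : ℝ) * (qden ρ (n + 1) * ρ - pnum ρ (n + 1)) = -(x * α) := by linarith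
    have hnew : (s : ℝ) * (qden ρ (n + 1 + 1) * ρ - pnum ρ (n + 1 + 1)) = x * x' * α := by
      rw [hq, hp]
      calc _ = cfA ρ (n + 1) * (s * (qden ρ (n + 1) * ρ - pnum ρ (n + 1))) + α := by
            rw [hαd]; ring
        _ = _ := by rw [hβ]; linear_combination -α * hxa
    have h3 : 0 < x * x' * α := by have := h1.1; have := h2.1; positivity
    have h4 : x * x' * α < x * α := by
      have : 0 < x * α := mul_pos h1.1 hα
      nlinarith [h2.2]
    refine ⟨?_, by push_cast; linear_combination hnew + x' * hβ⟩
    have key := hc.next (a := cfA ρ (n + 1)) (by exact_mod_cast one_le_cfA hirr (n + 1)) (by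
        rw [hq, hp] at hnew
        push_cast
        nlinarith) (by
        rw [hq, hp] at hnew
        push_cast
        nlinarith)
    convert key using 1
    · push_cast; ring
    · ring
    · simp [qden]
    · simp only [pnum]; push_cast; ring

/-! ### The cross-ratio inequality -/

/-- `h` distorts cross-ratios by a bounded factor, which is close to `1` on short intervals
avoiding the integer translates of `C`. -/
def CrossRatioControl (h : ℝ → ℝ) (C : Finset ℝ) (K : ℝ) : Prop :=
  ∀ a b c d : ℝ, a < b → b < c → c < d → d ≤ a + 5 →
    crossRatio (h a) (h b) (h c) (h d) ≤ Real.exp K * crossRatio a b c d ∧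
    ((∀ t ∈ Icc a d, ∀ c' ∈ C, ∀ k : ℤ, t ≠ c' + k) →
      crossRatio (h a) (h b) (h c) (h d) ≤ Real.exp (K * (d - a)) * crossRatio a b c d)

lemma CrossRatioControl.exists_variation {h : ℝ → ℝ} {C : Finset ℝ} {K : ℝ} (hK : 0 ≤ K)
    (hh : CrossRatioControl h C K) :
    ∃ (V : ℝ → ℝ) (V₁ : ℝ), Monotone V ∧ (∀ x, V (x + 1) = V x + V₁) ∧
      ∀ a b c d e : ℝ, a < b → b < c → c < d → d < e → e ≤ a + 5 →
        crossRatio (h a) (h b) (h c) (h d) ≤ Real.exp (V e - V a) * crossRatio a b c d := by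
  have hmono : Monotone fun x : ℝ => ∑ c ∈ C, (⌈x - c⌉ : ℝ) := fun x y hxy =>
    Finset.sum_le_sum fun c _ => by exact_mod_cast Int.ceil_mono (by linarith)
  refine ⟨fun x => K * (x + ∑ c ∈ C, (⌈x - c⌉ : ℝ)), K * (1 + C.card), ?_, ?_, ?_⟩
  · intro x y hxy
    exact mul_le_mul_of_nonneg_left (add_le_add hxy (hmono hxy)) hK
  · intro x
    beta_reduce
    have : ∀ c ∈ C, (⌈x + 1 - c⌉ : ℝ) = ⌈x - c⌉ + 1 := fun c _ => by
      rw [show x + 1 - c = x - c + 1 by ring, Int.ceil_add_one]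
      push_cast
      rfl
    rw [Finset.sum_congr rfl this, Finset.sum_add_distrib]
    simp only [Finset.sum_const, nsmul_eq_mul, mul_one]
    ring
  · intro a b c d e hab hbc hcd hde hea
    have hcr := (crossRatio_pos hab hbc hcd).le
    obtain ⟨h1, h2⟩ := hh a b c d hab hbc hcd (by linarith)
    have hm := hmono (show a ≤ e by linarith)
    simp only at hm
    by_cases hc : ∀ t ∈ Icc a d, ∀ c' ∈ C, ∀ k : ℤ, t ≠ c' + k
    · refine (h2 hc).trans ?_
      gcongr
      rw [← mul_sub]
      exact mul_le_mul_of_nonneg_left (by linarith) hK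
    · push Not at hc
      obtain ⟨t, ht, c', hc', k, rfl⟩ := hc
      refine h1.trans ?_
      gcongr
      rw [← mul_sub]
      have hjump : ∑ c ∈ C, (⌈a - c⌉ : ℝ) + 1 ≤ ∑ c ∈ C, (⌈e - c⌉ : ℝ) := by
        have hle : ∀ c ∈ C, (⌈a - c⌉ : ℝ) + (if c = c' then 1 else 0) ≤ ⌈e - c⌉ := by
          intro c _
          split_ifs with hcc
          · subst hcc
            have h3 : ⌈a - c⌉ ≤ k := Int.ceil_le.2 (by linarith [ht.1])
            have h4 : k < ⌈e - c⌉ := Int.lt_ceil.2 (by linarith [ht.2])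
            exact_mod_cast (by omega : ⌈a - c⌉ + 1 ≤ ⌈e - c⌉)
          · rw [add_zero]
            exact_mod_cast Int.ceil_mono (by linarith : a - c ≤ e - c)
        have := Finset.sum_le_sum hle
        rwa [Finset.sum_add_distrib, Finset.sum_ite_eq' C c', if_pos hc'] at this
      nlinarith

lemma sum_sub_le_of_disjoint {ι : Type*} {V : ℝ → ℝ} (hV : Monotone V) (s : Finset ι)
    (u v : ι → ℝ) (a : ℝ) (huv : ∀ i ∈ s, a ≤ u i ∧ u i < v i)
    (hdis : ∀ i ∈ s, ∀ j ∈ s, i ≠ j → v i ≤ u j ∨ v j ≤ u i) (b : ℝ) (hab : a ≤ b)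
    (hb : ∀ i ∈ s, v i ≤ b) : ∑ i ∈ s, (V (v i) - V (u i)) ≤ V b - V a := by
  classical
  induction s using Finset.induction_on_max_value u generalizing b with
  | empty => simpa using hV hab
  | insert i s hi hmax ih =>
    rw [Finset.sum_insert hi]
    have hui := huv i (Finset.mem_insert_self i s)
    have h1 := ih (fun j hj => huv j (Finset.mem_insert_of_mem hj))
      (fun j hj k hk => hdis j (Finset.mem_insert_of_mem hj) k (Finset.mem_insert_of_mem hk))
      (u i) hui.1 fun j hj => by
        have hne : j ≠ i := fun h => hi (h ▸ hj)
        rcases hdis j (Finset.mem_insert_of_mem hj) i (Finset.mem_insert_self i s) hne with h | h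
        · exact h
        · linarith [hmax j hj]
    have h2 := hV (hb i (Finset.mem_insert_self i s))
    linarith

/-- The total variation over intervals which are disjoint modulo `1`. -/
lemma sum_sub_le_of_disjoint_mod_one {V : ℝ → ℝ} {V₁ : ℝ} (hV : Monotone V)
    (hp : ∀ x, V (x + 1) = V x + V₁) (n : ℕ) (u v : ℕ → ℝ) (huv : ∀ i, u i < v i)
    (hdis : ∀ i < n, ∀ j < n, ∀ k : ℤ, (i ≠ j ∨ k ≠ 0) → v i ≤ u j + k ∨ v j + k ≤ u i) :
    ∑ i ∈ Finset.range n, (V (v i) - V (u i)) ≤ V₁ := by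
  have hp' : ∀ (k : ℤ) x, V (x - k) = V x - k * V₁ := by
    have hper : Function.Periodic (fun x => V x - x * V₁) 1 := fun x => by
      simp only [hp]; ring
    intro k x
    have := hper.sub_zsmul_eq k (x := x)
    simp only [zsmul_eq_mul, mul_one] at this
    linarith
  rcases Nat.eq_zero_or_pos n with rfl | hn
  · have h1 := hV (show (0 : ℝ) ≤ 0 + 1 by norm_num)
    rw [hp] at h1
    simpa using h1
  set κ : ℕ → ℤ := fun i => ⌊u i - u 0⌋ with hκ
  have hlo : ∀ i, (κ i : ℝ) ≤ u i - u 0 := fun i => Int.floor_le _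
  have hhi : ∀ i, u i - u 0 < κ i + 1 := fun i => Int.lt_floor_add_one _
  have key := sum_sub_le_of_disjoint hV (Finset.range n) (fun i => u i - κ i)
    (fun i => v i - κ i) (u 0) (fun i _ => ⟨by linarith [hlo i], by linarith [huv i]⟩) ?_
    (u 0 + 1) (by linarith) ?_
  · rw [hp, add_sub_cancel_left] at key
    refine le_trans (le_of_eq (Finset.sum_congr rfl fun i _ => ?_)) key
    rw [hp', hp']
    ring
  · intro i hi j hj hij
    have h := hdis i (Finset.mem_range.1 hi) j (Finset.mem_range.1 hj) (κ i - κ j) (Or.inl hij)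
    push_cast at h
    rcases h with h | h
    · left; linarith
    · right; linarith
  · intro i hi
    have h := hdis i (Finset.mem_range.1 hi) 0 hn (κ i + 1) (by
      by_cases h0 : i = 0
      · right; rw [h0]; simp [hκ]
      · left; exact h0)
    push_cast at h
    rcases h with h | h
    · linarith
    · linarith [hhi i, huv 0]

/-- Iterates of `e` up to the time `q'` distort cross-ratios by at most `B` on intervals
covered by four consecutive iterates of a fundamental domain of the return map `orb e q p`. -/
def CrossRatioInequality (e : ℝ ≃o ℝ) (q p q' : ℤ) (B : ℝ) : Prop :=
  ∀ y a b c d : ℝ, orb e (-2 * q) (-2 * p) y ≤ a → a < b → b < c → c < d →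
    d ≤ orb e (2 * q) (2 * p) y → ∀ m k : ℤ, 0 ≤ m → m ≤ q' →
    crossRatio (orb e m k a) (orb e m k b) (orb e m k c) (orb e m k d) ≤ B * crossRatio a b c d

lemma Convergents.sum_variation_le {e : ℝ ≃o ℝ} {ρ : ℝ} (he : OrderedAsRotation e ρ)
    {q p q' p' : ℤ} (hc : Convergents ρ q p q' p') {V : ℝ → ℝ} {V₁ : ℝ} (hV : Monotone V)
    (hp : ∀ x, V (x + 1) = V x + V₁) (n : ℕ) (hn : n ≤ q') (y : ℝ) :
    ∑ i ∈ Finset.range n, (V (orb e i 0 (orb e q p y)) - V (orb e i 0 y)) ≤ V₁ := by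
  refine sum_sub_le_of_disjoint_mod_one hV hp n (fun i => orb e i 0 y)
    (fun i => orb e i 0 (orb e q p y)) (fun i => ?_) ?_
  · exact orb_strictMono e i 0 (he.lt_orb q p hc.pos y)
  · intro i hi j hj k hijk
    have h := hc.best_approx (j := i - j) (k := k) (by rw [abs_lt]; omega)
      (by rcases hijk with h | h
          · left; omega
          · right; omega)
    have hshift : ∀ (q p : ℤ), orb e q p y + k = orb e q (p - k) y := fun q p => by
      simp only [orb]; push_cast; ring
    simp only [he.orb_orb, hshift]
    push_cast at h
    rcases le_abs.1 h with h | h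
    · right; exact he.orb_le_orb (by push_cast; linarith) y
    · left; exact he.orb_le_orb (by push_cast; linarith) y

lemma crossRatio_orb_add_int {e : ℝ ≃o ℝ} (m k : ℤ) (a b c d : ℝ) :
    crossRatio (orb e m k a) (orb e m k b) (orb e m k c) (orb e m k d) =
      crossRatio (orb e m 0 a) (orb e m 0 b) (orb e m 0 c) (orb e m 0 d) := by
  have h : ∀ x, orb e m k x = orb e m 0 x + (-k : ℝ) := fun x => by
    simp only [orb]; push_cast; ring
  simp only [h, crossRatio_add_const]

lemma CrossRatioControl.exists_inequality {e : ℝ ≃o ℝ} {ρ : ℝ} {C : Finset ℝ} {K : ℝ}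
    (hK : 0 ≤ K) (hcr : CrossRatioControl e C K) (he : OrderedAsRotation e ρ) :
    ∃ B ≥ 1, ∀ q p q' p', Convergents ρ q p q' p' → CrossRatioInequality e q p q' B := by
  obtain ⟨V, V₁, hV, hp, hstep⟩ := hcr.exists_variation hK
  have hV₁ : 0 ≤ V₁ := by
    have := hV (show (0 : ℝ) ≤ 0 + 1 by norm_num)
    rw [hp] at this
    linarith
  refine ⟨Real.exp (5 * V₁), Real.one_le_exp (by positivity), ?_⟩
  intro q p q' p' hc y a b c d ha hab hbc hcd hd m k hm hmq
  obtain ⟨m, rfl⟩ := Int.eq_ofNat_of_zero_le hm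
  rw [crossRatio_orb_add_int]
  set w : ℤ → ℝ := fun t => orb e (t * q) (t * p) y with hw
  have hiter : crossRatio (orb e m 0 a) (orb e m 0 b) (orb e m 0 c) (orb e m 0 d) ≤
      Real.exp (∑ i ∈ Finset.range m, (V (orb e i 0 (w 3)) - V (orb e i 0 (w (-2))))) *
        crossRatio a b c d := by
    clear hm hmq
    induction m with
    | zero => simp [orb_zero_zero]
    | succ m ih =>
      have hs : ∀ x, orb e (m + 1 : ℕ) 0 x = e (orb e m 0 x) := fun x => by
        rw [← orb_one_zero e (orb e m 0 x), he.orb_orb]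
        congr 1
        push_cast
        ring
      have hmono := orb_strictMono e m 0
      have h1 : orb e m 0 (w (-2)) ≤ orb e m 0 a := hmono.monotone ha
      have h2 : orb e m 0 (w 3) ≤ orb e m 0 (w (-2)) + 5 := by
        rw [show orb e m 0 (w (-2)) + 5 = orb e 0 (-5) (orb e m 0 (w (-2))) by simp [orb]]
        simp only [hw, he.orb_orb]
        apply he.orb_le_orb
        push_cast
        linarith [hc.lt_one]
      have h3 : d < w 3 := hd.trans_lt (he.orb_lt_orb (by push_cast; linarith [hc.pos]) y)
      have h4 := hstep (orb e m 0 a) (orb e m 0 b) (orb e m 0 c) (orb e m 0 d)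
        (orb e m 0 (w 3)) (hmono hab) (hmono hbc) (hmono hcd) (hmono h3) (by linarith)
      simp only [hs]
      refine h4.trans ?_
      rw [Finset.sum_range_succ, add_comm, Real.exp_add, mul_assoc]
      have h5 := (crossRatio_pos (hmono hab) (hmono hbc) (hmono hcd)).le
      have h6 := hV h1
      gcongr
  refine hiter.trans ?_
  have hcr := (crossRatio_pos hab hbc hcd).le
  gcongr
  have hS : ∀ t, ∑ i ∈ Finset.range m, V (orb e i 0 (w (t + 1))) -
      ∑ i ∈ Finset.range m, V (orb e i 0 (w t)) ≤ V₁ := by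
    intro t
    rw [← Finset.sum_sub_distrib]
    have := hc.sum_variation_le he hV hp m hmq (w t)
    rwa [show orb e q p (w t) = w (t + 1) by
      simp only [hw, he.orb_orb]; congr 1 <;> ring] at this
  rw [Finset.sum_sub_distrib]
  have h1 := hS (-2)
  have h2 := hS (-1)
  have h3 := hS 0
  have h4 := hS 1
  have h5 := hS 2
  norm_num at h1 h2 h3 h4 h5
  linarith

lemma CrossRatioInequality.iterate {e : ℝ ≃o ℝ} {ρ : ℝ} (he : OrderedAsRotation e ρ)
    {q p q' : ℤ} {B : ℝ} (hB : 1 ≤ B) (hq' : 0 ≤ q') (h : CrossRatioInequality e q p q' B) (N : ℕ)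
    {y a b c d : ℝ} (ha : orb e (-2 * q) (-2 * p) y ≤ a) (hab : a < b) (hbc : b < c) (hcd : c < d)
    (hd : d ≤ orb e (2 * q) (2 * p) y) {m : ℤ} (k : ℤ) (hm : 0 ≤ m) (hmN : m ≤ N * q') :
    crossRatio (orb e m k a) (orb e m k b) (orb e m k c) (orb e m k d) ≤
      B ^ N * crossRatio a b c d := by
  induction N generalizing y a b c d m with
  | zero =>
    obtain rfl : m = 0 := by simp at hmN; omega
    rw [crossRatio_orb_add_int]
    simp [orb_zero_zero]
  | succ N ih =>
    have hcr := (crossRatio_pos hab hbc hcd).le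
    rcases le_total m (N * q') with hle | hle
    · refine (ih ha hab hbc hcd hd hm hle).trans ?_
      gcongr
      omega
    · have hmono := orb_strictMono e (N * q') 0
      have h1 := ih ha hab hbc hcd hd (m := N * q') (by positivity) le_rfl
      rw [crossRatio_orb_add_int] at h1
      have hcomm : ∀ t, orb e (N * q') 0 (orb e (t * q) (t * p) y) =
          orb e (t * q) (t * p) (orb e (N * q') 0 y) := fun t => by
        rw [he.orb_orb, he.orb_orb, add_comm, add_comm (0 : ℤ)]
      have h2 := h (orb e (N * q') 0 y) _ _ _ _ (by rw [← hcomm]; exact hmono.monotone ha)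
        (hmono hab) (hmono hbc) (hmono hcd) (by rw [← hcomm]; exact hmono.monotone hd)
        (m - N * q') k (by linarith) (by push_cast at hmN; linarith)
      simp only [he.orb_orb, sub_add_cancel, add_zero] at h2
      refine h2.trans ?_
      calc _ ≤ B * (B ^ N * crossRatio a b c d) := by gcongr
        _ = _ := by ring

/-! ### Comparability of return distances -/

section CrossRatioBounds

variable {a b c d κ : ℝ}

lemma crossRatio_mul_le_left (hab : a < b) (hbc : b < c) (hcd : c < d) :
    crossRatio a b c d * (c - b) ≤ b - a := by
  have h1 : 0 < c - a := by linarith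
  have h2 : 0 < d - b := by linarith
  rw [crossRatio, div_mul_eq_mul_div, div_le_iff₀ (by positivity)]
  nlinarith [mul_pos (sub_pos.2 hab) (sub_pos.2 hbc), mul_pos (sub_pos.2 hab) (sub_pos.2 hcd),
    mul_pos (sub_pos.2 hab) (mul_pos h1 h2), mul_nonneg (sub_pos.2 hab).le
      (sub_nonneg.2 (mul_le_mul (by linarith : c - b ≤ c - a) (by linarith : d - c ≤ d - b)
        (sub_pos.2 hcd).le h1.le))]

lemma crossRatio_mul_le_right (hab : a < b) (hbc : b < c) (hcd : c < d) :
    crossRatio a b c d * (c - b) ≤ d - c := by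
  have := crossRatio_mul_le_left (neg_lt_neg hcd) (neg_lt_neg hbc) (neg_lt_neg hab)
  rw [crossRatio_neg, crossRatio_reverse] at this
  linarith

lemma sub_le_mul_crossRatio (hκ : 0 ≤ κ) (hab : a < b) (hbc : b < c) (hcd : c < d)
    (hl : b - a ≤ κ * (c - b)) (hr : c - b ≤ κ * (d - c)) :
    b - a ≤ (1 + κ) ^ 2 * (c - b) * crossRatio a b c d := by
  have h1 : 0 < c - a := by linarith
  have h2 : 0 < d - b := by linarith
  rw [crossRatio, mul_div_assoc', le_div_iff₀ (by positivity)]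
  have h3 : c - a ≤ (1 + κ) * (c - b) := by linarith
  have h4 : d - b ≤ (1 + κ) * (d - c) := by linarith
  have h5 : 0 < b - a := by linarith
  calc (b - a) * ((c - a) * (d - b)) ≤ (b - a) * (((1 + κ) * (c - b)) * ((1 + κ) * (d - c))) := by
        have : 0 < c - b := by linarith
        gcongr
    _ = _ := by ring

lemma one_le_mul_crossRatio (hκ : 0 ≤ κ) (hab : a < b) (hbc : b < c) (hcd : c < d)
    (hl : c - b ≤ κ * (b - a)) (hr : c - b ≤ κ * (d - c)) :
    1 ≤ (1 + κ) ^ 2 * crossRatio a b c d := by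
  have h1 : 0 < c - a := by linarith
  have h2 : 0 < d - b := by linarith
  rw [crossRatio, mul_div_assoc', le_div_iff₀ (by positivity)]
  have h3 : c - a ≤ (1 + κ) * (b - a) := by linarith
  have h4 : d - b ≤ (1 + κ) * (d - c) := by linarith
  have h5 : 0 < b - a := by linarith
  calc 1 * ((c - a) * (d - b)) ≤ ((1 + κ) * (b - a)) * ((1 + κ) * (d - c)) := by
        rw [one_mul]
        gcongr
    _ = _ := by ring

end CrossRatioBounds

/-- The signed distance from `x` to its image under `orb e q p`. -/
def gap (e : ℝ ≃o ℝ) (q p : ℤ) (x : ℝ) : ℝ := orb e q p x - x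

lemma OrderedAsRotation.gap_add_int {e : ℝ ≃o ℝ} {ρ : ℝ} (he : OrderedAsRotation e ρ)
    (q p k : ℤ) (x : ℝ) : gap e q p (x + k) = gap e q p x := by
  rw [gap, he.orb_add_int, gap]
  ring

lemma OrderedAsRotation.exists_gap_min {e : ℝ ≃o ℝ} {ρ : ℝ} (he : OrderedAsRotation e ρ)
    (q p : ℤ) : ∃ z, ∀ x, gap e q p z ≤ gap e q p x :=
  exists_forall_le_of_periodic ((orb_continuous e q p).sub continuous_id) fun x => by
    exact_mod_cast he.gap_add_int q p 1 x

section Convergents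

variable {e : ℝ ≃o ℝ} {ρ : ℝ} {q p q' p' : ℤ} {B : ℝ}

lemma Convergents.gap_pos (hc : Convergents ρ q p q' p') (he : OrderedAsRotation e ρ) (x : ℝ) :
    0 < gap e q p x := sub_pos.2 (he.lt_orb q p hc.pos x)

/-- A config of four consecutive returns of `x`, translated by an iterate of `e`. -/
lemma CrossRatioInequality.crossRatio_le (hcri : CrossRatioInequality e q p q' B) (hB : 1 ≤ B)
    (he : OrderedAsRotation e ρ) (hc : Convergents ρ q p q' p') (N : ℕ) {a b : ℝ}
    (ha : orb e (-q) (-p) b ≤ a) (hab : a < b) {m : ℤ} (k : ℤ) (hm : 0 ≤ m) (hmN : m ≤ N * q') :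
    crossRatio (orb e m k a) (orb e m k b) (orb e q p (orb e m k b))
      (orb e q p (orb e q p (orb e m k b))) ≤
      B ^ N * crossRatio a b (orb e q p b) (orb e q p (orb e q p b)) := by
  have h := hcri.iterate he hB (by have := hc.one_le; have := hc.le; omega) N (y := b)
    ((he.orb_le_orb (by push_cast; linarith [hc.pos]) b).trans ha) hab
    (he.lt_orb q p hc.pos b) (he.lt_orb q p hc.pos (orb e q p b))
    (by rw [he.orb_orb, two_mul, two_mul]) k hm hmN
  have hcomm : ∀ x, orb e m k (orb e q p x) = orb e q p (orb e m k x) := fun x => by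
    rw [he.orb_orb, he.orb_orb, add_comm, add_comm k]
  rwa [hcomm, hcomm, hcomm] at h

lemma gap_le_of_preimage_of_min (hcri : CrossRatioInequality e q p q' B) (hB : 1 ≤ B)
    (he : OrderedAsRotation e ρ) (hc : Convergents ρ q p q' p') {z : ℝ}
    (hz : ∀ x, gap e q p z ≤ gap e q p x) {i : ℤ} (k : ℤ) (hi : 0 ≤ i) (hiq : i ≤ 12 * q') :
    gap e q p (orb e (-i) k z) ≤ 4 * B ^ 12 * gap e q p (orb e (-q) (-p) (orb e (-i) k z)) ∧
    gap e q p (orb e (-i) k z) ≤ 4 * B ^ 12 * gap e q p (orb e q p (orb e (-i) k z)) := by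
  set w := orb e (-i) k z with hw
  have hpos := fun x => hc.gap_pos he x
  have hback : ∀ x, orb e q p (orb e (-q) (-p) x) = x := fun x => by
    rw [he.orb_orb, add_neg_cancel, add_neg_cancel, orb_zero_zero]
  have hlt : ∀ x, orb e (-q) (-p) x < x := fun x => by
    have := hpos (orb e (-q) (-p) x)
    rwa [gap, hback, sub_pos] at this
  have hgt : ∀ x, x < orb e q p x := fun x => he.lt_orb q p hc.pos x
  have h := hcri.crossRatio_le hB he hc 12 le_rfl (hlt w) (-k) hi (by push_cast; exact hiq)
  have hz' : orb e i (-k) w = z := by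
    rw [hw, he.orb_orb, add_neg_cancel, neg_add_cancel, orb_zero_zero]
  rw [show orb e i (-k) (orb e (-q) (-p) w) = orb e (-q) (-p) (orb e i (-k) w) by
    rw [he.orb_orb i, he.orb_orb (-q), add_comm, add_comm (-k)], hz'] at h
  have h1 := one_le_mul_crossRatio (κ := 1) zero_le_one (hlt z) (hgt z) (hgt _)
    (by have := hz (orb e (-q) (-p) z)
        rw [gap, gap, hback] at this
        linarith)
    (by have := hz (orb e q p z)
        rw [gap, gap] at this
        linarith)
  have h2 := crossRatio_mul_le_left (hlt w) (hgt w) (hgt _)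
  have h3 := crossRatio_mul_le_right (hlt w) (hgt w) (hgt _)
  set X := crossRatio (orb e (-q) (-p) w) w (orb e q p w) (orb e q p (orb e q p w))
  have h4 : 1 ≤ 4 * B ^ 12 * X := by nlinarith
  have h5 : 0 ≤ 4 * B ^ 12 := by positivity
  have h6 : gap e q p w ≤ 4 * B ^ 12 * (X * gap e q p w) := by
    rw [← mul_assoc]
    exact le_mul_of_one_le_left (hpos w).le h4
  constructor
  · refine h6.trans (mul_le_mul_of_nonneg_left ?_ h5)
    rwa [gap, gap, hback]
  · exact h6.trans (mul_le_mul_of_nonneg_left h3 h5)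

lemma gap_comparable_near_preimage_of_min (hcri : CrossRatioInequality e q p q' B) (hB : 1 ≤ B)
    (he : OrderedAsRotation e ρ) (hc : Convergents ρ q p q' p') {z : ℝ}
    (hz : ∀ x, gap e q p z ≤ gap e q p x) {A : ℝ} (hA : A = 4 * B ^ 12) {i : ℤ} (k : ℤ)
    (hi : 3 * q' ≤ i) (hiq : i ≤ 8 * q') {x : ℝ} (hx : orb e (-i) k z ≤ x)
    (hx' : x ≤ orb e q p (orb e (-i) k z)) :
    gap e q p x ≤ A * B * (1 + 2 * A) ^ 2 * gap e q p (orb e (-i) k z) ∧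
    gap e q p (orb e (-i) k z) ≤ A * B * (1 + 2 * A) ^ 2 * gap e q p x := by
  have hq := hc.one_le
  have hqq := hc.le
  have hgt : ∀ x, x < orb e q p x := fun x => he.lt_orb q p hc.pos x
  have hpos := fun x => hc.gap_pos he x
  have hstep : ∀ t : ℤ, orb e q p (orb e (-(i - t * q)) (k + t * p) z) =
      orb e (-(i - (t + 1) * q)) (k + (t + 1) * p) z := fun t => by
    rw [he.orb_orb]; congr 1 <;> ring
  have hback : ∀ x, orb e (-q) (-p) (orb e q p x) = x := fun x => by
    rw [he.orb_orb, neg_add_cancel, neg_add_cancel, orb_zero_zero]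
  have hgap : ∀ t : ℤ, 0 ≤ t → t ≤ 3 →
      gap e q p (orb e (-(i - t * q)) (k + t * p) z) ≤
        A * gap e q p (orb e (-q) (-p) (orb e (-(i - t * q)) (k + t * p) z)) ∧
      gap e q p (orb e (-(i - t * q)) (k + t * p) z) ≤
        A * gap e q p (orb e q p (orb e (-(i - t * q)) (k + t * p) z)) := by
    intro t ht0 ht3
    rw [hA]
    exact gap_le_of_preimage_of_min hcri hB he hc hz _ (by nlinarith) (by nlinarith)
  have h0 := hgap 0 le_rfl (by norm_num)
  have h1 := hgap 1 (by norm_num) (by norm_num)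
  have h2 := hgap 2 (by norm_num) (by norm_num)
  rw [← one_add_one_eq_two, ← hstep 1] at h2
  rw [← zero_add (1 : ℤ), ← hstep 0] at h1 h2
  simp only [zero_mul, sub_zero, add_zero, hback] at h0 h1 h2
  set w := orb e (-i) k z
  set w₁ := orb e q p w with hw₁
  set w₂ := orb e q p w₁ with hw₂
  set w₃ := orb e q p w₂ with hw₃
  have hA1 : 1 ≤ A := by
    have : 1 ≤ B ^ 12 := one_le_pow₀ hB
    rw [hA]; linarith
  have hBA : 1 ≤ B * (1 + 2 * A) ^ 2 := by nlinarith
  have hP := hpos x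
  have hP0 := hpos w
  have hgx : orb e q p x ≤ w₂ := (orb_strictMono e q p).monotone hx'
  have hgx' : w₁ ≤ orb e q p x := (orb_strictMono e q p).monotone hx
  have e0 : gap e q p w = w₁ - w := rfl
  have e1 : gap e q p w₁ = w₂ - w₁ := rfl
  have e2 : gap e q p w₂ = w₃ - w₂ := rfl
  constructor
  · have h3 : gap e q p x ≤ (1 + A) * gap e q p w := by
      have : gap e q p x = orb e q p x - x := rfl
      linarith [h1.1]
    refine h3.trans ?_
    gcongr
    nlinarith
  · have h4 : gap e q p w ≤ A * gap e q p w₁ := h0.2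
    rcases hx'.eq_or_lt with rfl | hlt
    · refine h4.trans ?_
      gcongr
      nlinarith
    · have hg : gap e q p w₁ ≤ B * (1 + 2 * A) ^ 2 * gap e q p x := by
        have ex : gap e q p x = orb e q p x - x := rfl
        rcases le_total (gap e q p w₁) (2 * gap e q p x) with h5 | h5
        · refine h5.trans ?_
          gcongr
          nlinarith
        · have h6 := hcri.crossRatio_le hB he hc 1 (a := x) (b := w₁) (by rw [hback]; exact hx) hlt
            (m := q) p (by omega) (by push_cast; omega)
          have h7 : orb e q p x < w₂ := orb_strictMono e q p hlt
          have h8 := one_le_mul_crossRatio (κ := 2 * A) (by positivity) h7 (hgt w₂) (hgt w₃)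
            (by change w₃ - w₂ ≤ _; nlinarith [h2.1])
            (by change gap e q p w₂ ≤ 2 * A * gap e q p w₃; nlinarith [h2.2, hpos w₂])
          have h9 := crossRatio_mul_le_left hlt (hgt w₁) (hgt w₂)
          rw [pow_one] at h6
          set X := crossRatio x w₁ (orb e q p w₁) (orb e q p (orb e q p w₁))
          have h10 : 1 ≤ B * (1 + 2 * A) ^ 2 * X := by
            refine h8.trans ((mul_le_mul_of_nonneg_left h6 (by positivity)).trans_eq ?_)
            ring
          calc gap e q p w₁ ≤ B * (1 + 2 * A) ^ 2 * X * gap e q p w₁ :=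
                le_mul_of_one_le_left (hpos w₁).le h10
            _ = B * (1 + 2 * A) ^ 2 * (X * gap e q p w₁) := by ring
            _ ≤ _ := by
              gcongr
              refine h9.trans ?_
              linarith
      calc gap e q p w ≤ A * gap e q p w₁ := h4
        _ ≤ A * (B * (1 + 2 * A) ^ 2 * gap e q p x) := by gcongr
        _ = _ := by ring

/-- The first `q + q'` orbit points of `z` cut the line into intervals which are no longer than
fundamental domains of `orb e q p`. -/
lemma exists_orb_le_lt (he : OrderedAsRotation e ρ) (hc : Convergents ρ q p q' p') (z x : ℝ) :
    ∃ i k : ℤ, 0 ≤ i ∧ i < q + q' ∧ orb e i k z ≤ x ∧ x < orb e q p (orb e i k z) := by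
  have hq := hc.one_le
  have hqq := hc.le
  set κ : ℤ → ℤ := fun i => -⌊x - orb e i 0 z⌋ with hκ
  have hle : ∀ i, orb e i (κ i) z ≤ x := fun i => by
    have := Int.floor_le (x - orb e i 0 z)
    simp only [orb, hκ] at this ⊢
    push_cast at this ⊢
    linarith
  have hmax : ∀ i k, orb e i k z ≤ x → orb e i k z ≤ orb e i (κ i) z := fun i k h => by
    have h1 : -k ≤ ⌊x - orb e i 0 z⌋ := Int.le_floor.2 (by
      simp only [orb] at h ⊢; push_cast; linarith)
    have h2 : ((κ i : ℤ) : ℝ) ≤ k := by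
      have : κ i ≤ k := by simp only [hκ]; omega
      exact_mod_cast this
    simp only [orb]
    linarith
  obtain ⟨i, hi, him⟩ := (Finset.Ico 0 (q + q')).exists_max_image (fun i => orb e i (κ i) z)
    ⟨0, by simp; omega⟩
  rw [Finset.mem_Ico] at hi
  refine ⟨i, κ i, hi.1, hi.2, hle i, ?_⟩
  have key : ∀ j l : ℤ, 0 ≤ i + j → i + j < q + q' → 0 < j * ρ - l →
      x < orb e j l (orb e i (κ i) z) := by
    intro j l h0 h1 hpos
    by_contra! hx
    have h2 := he.lt_orb j l hpos (orb e i (κ i) z)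
    rw [he.orb_orb, add_comm j] at hx h2
    have h3 := him (i + j) (Finset.mem_Ico.2 ⟨h0, h1⟩)
    linarith [hmax _ _ hx]
  rcases lt_or_ge i q' with h | h
  · exact key q p (by omega) (by omega) hc.pos
  · refine (key (-q') (-p') (by omega) (by omega) (by push_cast; linarith [hc.neg])).trans_le ?_
    exact he.orb_le_orb (by push_cast; linarith [hc.add_pos]) _

end Convergents

/-- Returns of points within one return of each other have comparable lengths. -/
def ReturnsComparable (e : ℝ ≃o ℝ) (q p : ℤ) (A : ℝ) : Prop :=
  ∀ x, ∀ y ∈ uIcc x (orb e q p x),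
    |gap e q p x| ≤ A * |gap e q p y| ∧ |gap e q p y| ≤ A * |gap e q p x|

lemma ReturnsComparable.mono {e : ℝ ≃o ℝ} {q p : ℤ} {A A' : ℝ} (hA : A ≤ A')
    (h : ReturnsComparable e q p A) : ReturnsComparable e q p A' := fun x y hy =>
  ⟨(h x y hy).1.trans (by gcongr), (h x y hy).2.trans (by gcongr)⟩

lemma gap_mirror (e : ℝ ≃o ℝ) (q p : ℤ) (x : ℝ) :
    gap (mirror e) q p x = -gap e q (-p) (-x) := by
  simp only [gap, orb_mirror]
  ring

lemma mirror_mirror (e : ℝ ≃o ℝ) : mirror (mirror e) = e := by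
  ext x
  simp [mirror_apply]

lemma ReturnsComparable.mirror {e : ℝ ≃o ℝ} {q p : ℤ} {A : ℝ}
    (h : ReturnsComparable e q p A) : ReturnsComparable (mirror e) q (-p) A := by
  intro x y hy
  simp only [gap_mirror, neg_neg, abs_neg]
  apply h
  rw [orb_mirror, neg_neg] at hy
  rw [mem_uIcc] at hy ⊢
  rcases hy with hy | hy
  · right; constructor <;> linarith
  · left; constructor <;> linarith

/-- The cross-ratio inequality makes returns comparable. -/
lemma CrossRatioInequality.returnsComparable {e : ℝ ≃o ℝ} {ρ : ℝ} {q p q' p' : ℤ} {A B : ℝ}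
    (hcri : CrossRatioInequality e q p q' B) (hB : 1 ≤ B) (he : OrderedAsRotation e ρ)
    (hc : Convergents ρ q p q' p') (hA : A = 4 * B ^ 12) :
    ReturnsComparable e q p ((A * B * (1 + 2 * A) ^ 2) ^ 3) := by
  obtain ⟨z, hz⟩ := he.exists_gap_min q p
  have hq := hc.one_le
  have hqq := hc.le
  have hA1 : 1 ≤ A := by
    have : 1 ≤ B ^ 12 := one_le_pow₀ hB
    rw [hA]; linarith
  intro x y hy
  rw [uIcc_of_le (he.lt_orb q p hc.pos x).le] at hy
  rw [abs_of_pos (hc.gap_pos he x), abs_of_pos (hc.gap_pos he y)]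
  obtain ⟨i, k, hi0, hi1, hwx, hxw⟩ := exists_orb_le_lt he hc (orb e (-(7 * q')) 0 z) x
  have hw : orb e i k (orb e (-(7 * q')) 0 z) = orb e (-(7 * q' - i)) k z := by
    rw [he.orb_orb, add_zero]; congr 1; ring
  rw [hw] at hwx hxw
  have hw₁ : orb e q p (orb e (-(7 * q' - i)) k z) = orb e (-(7 * q' - i - q)) (p + k) z := by
    rw [he.orb_orb]; congr 1; ring
  have hnear := fun {u : ℝ} => gap_comparable_near_preimage_of_min hcri hB he hc hz hA
    (i := 7 * q' - i) k (by omega) (by omega) (x := u)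
  have hnear₁ := fun {u : ℝ} => gap_comparable_near_preimage_of_min hcri hB he hc hz hA
    (i := 7 * q' - i - q) (p + k) (by omega) (by omega) (x := u)
  rw [← hw₁] at hnear₁
  set w := orb e (-(7 * q' - i)) k z
  have hww := he.lt_orb q p hc.pos w
  set D := A * B * (1 + 2 * A) ^ 2 with hD
  have hD1 : 1 ≤ D := by
    have : 1 ≤ A * B := by nlinarith
    have : 1 ≤ (1 + 2 * A) ^ 2 := by nlinarith
    nlinarith
  obtain ⟨h1, h2⟩ := hnear hwx hxw.le
  have hP := hc.gap_pos he w
  have key : gap e q p w ≤ D ^ 2 * gap e q p y ∧ gap e q p y ≤ D ^ 2 * gap e q p w := by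
    rcases le_total y (orb e q p w) with hyw | hyw
    · obtain ⟨h3, h4⟩ := hnear (hwx.trans hy.1) hyw
      have h5 : D ≤ D ^ 2 := by nlinarith
      have := hc.gap_pos he y
      exact ⟨h4.trans (by gcongr), h3.trans (by gcongr)⟩
    · obtain ⟨h3, h4⟩ := hnear₁ hyw (hy.2.trans ((orb_strictMono e q p).monotone hxw.le))
      obtain ⟨h5, h6⟩ := hnear hww.le le_rfl
      constructor
      · calc _ ≤ D * gap e q p (orb e q p w) := h6
          _ ≤ D * (D * gap e q p y) := by gcongr
          _ = _ := by ring
      · calc _ ≤ D * gap e q p (orb e q p w) := h3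
          _ ≤ D * (D * gap e q p w) := by gcongr
          _ = _ := by ring
  constructor
  · calc _ ≤ D * gap e q p w := h1
      _ ≤ D * (D ^ 2 * gap e q p y) := by gcongr; exact key.1
      _ = _ := by ring
  · calc _ ≤ D ^ 2 * gap e q p w := key.2
      _ ≤ D ^ 2 * (D * gap e q p x) := by gcongr
      _ = _ := by ring

/-! ### Comparison of consecutive returns along critical orbits -/

/-- `h` behaves like a power of exponent `d` around the point `c`. -/
def PowerLaw (h : ℝ → ℝ) (c d K : ℝ) : Prop :=
  ∀ x y : ℝ, |x - c| ≤ 5 → |y - c| ≤ 5 →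
    |h x - h c| * |y - c| ^ d ≤ K * (|x - c| ^ d * |h y - h c|)

section Convergents

variable {e : ℝ ≃o ℝ} {ρ : ℝ} {q p q' p' : ℤ} {A B : ℝ}

lemma Convergents.gap_neg (hc : Convergents ρ q p q' p') (he : OrderedAsRotation e ρ) (x : ℝ) :
    gap e q' p' x < 0 := by
  have := he.orb_lt_orb (q := q') (p := p') (q' := 0) (p' := 0) (by simpa using hc.neg) x
  rw [orb_zero_zero] at this
  exact sub_neg.2 this

lemma Convergents.orb_neg_le (hc : Convergents ρ q p q' p') (he : OrderedAsRotation e ρ) (x : ℝ) :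
    orb e (-q) (-p) x ≤ orb e q' p' x :=
  he.orb_le_orb (by push_cast; linarith [hc.add_pos]) x

lemma ReturnsComparable.gap_le (hA : ReturnsComparable e q p A) (hc : Convergents ρ q p q' p')
    (he : OrderedAsRotation e ρ) {x y : ℝ} (hxy : x ≤ y) (hy : y ≤ orb e q p x) :
    gap e q p x ≤ A * gap e q p y ∧ gap e q p y ≤ A * gap e q p x := by
  have := hA x y (by rw [mem_uIcc]; exact Or.inl ⟨hxy, hy⟩)
  rwa [abs_of_pos (hc.gap_pos he x), abs_of_pos (hc.gap_pos he y)] at this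

lemma ReturnsComparable.neg_gap_le (hA : ReturnsComparable e q' p' A)
    (hc : Convergents ρ q p q' p') (he : OrderedAsRotation e ρ) (x : ℝ) :
    -gap e q' p' x ≤ A * -gap e q' p' (orb e q' p' x) := by
  have := (hA x (orb e q' p' x) right_mem_uIcc).1
  rwa [abs_of_neg (hc.gap_neg he _), abs_of_neg (hc.gap_neg he _)] at this

/-- The return of `x` of order `(q', p')` lies within one return of order `(q, p)`. -/
lemma ReturnsComparable.gap_orb_le (hA : ReturnsComparable e q p A)
    (hc : Convergents ρ q p q' p') (he : OrderedAsRotation e ρ) (x : ℝ) :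
    gap e q p (orb e q' p' x) ≤ A * gap e q p x := by
  refine (hA.gap_le hc he (x := orb e q' p' x) (y := x) ?_ ?_).1
  · linarith [hc.gap_neg he x, show gap e q' p' x = orb e q' p' x - x from rfl]
  · have := (orb_strictMono e q p).monotone (hc.orb_neg_le he x)
    rwa [he.orb_orb, add_neg_cancel, add_neg_cancel, orb_zero_zero] at this

lemma ReturnsComparable.neg_gap_le_crossRatio (hA : ReturnsComparable e q p A) (hA1 : 1 ≤ A)
    (hc : Convergents ρ q p q' p') (he : OrderedAsRotation e ρ) (x : ℝ) :
    -gap e q' p' x ≤ (1 + A) ^ 2 * gap e q p x *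
      crossRatio (orb e q' p' x) x (orb e q p x) (orb e q p (orb e q p x)) := by
  have hgt : ∀ x, x < orb e q p x := fun x => he.lt_orb q p hc.pos x
  have hlt : orb e q' p' x < x := sub_neg.1 (hc.gap_neg he x)
  have hback : orb e q p (orb e (-q) (-p) x) = x := by
    rw [he.orb_orb, add_neg_cancel, add_neg_cancel, orb_zero_zero]
  have h1 := (hA.gap_le hc he (x := orb e (-q) (-p) x) (y := x)
    ((hc.orb_neg_le he x).trans hlt.le) hback.ge).1
  rw [gap, gap, hback] at h1
  have h2 := (hA.gap_le hc he (hgt x).le le_rfl).1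
  have := sub_le_mul_crossRatio (κ := A) (by linarith) hlt (hgt x) (hgt _)
    (by linarith [hc.orb_neg_le he x]) h2
  rwa [gap, neg_sub]

lemma rpow_le_of_mul_rpow_le {a b M d : ℝ} (ha : 0 < a) (hb : 0 < b) (hM : 0 < M) (hd : 1 < d)
    (h : a * b ^ d ≤ M * b * a ^ d) : b ≤ M ^ (d - 1)⁻¹ * a := by
  have hd' : 0 < d - 1 := by linarith
  have e1 : ∀ x : ℝ, 0 < x → x ^ d = x ^ (d - 1) * x := fun x hx => by
    rw [← Real.rpow_add_one hx.ne', sub_add_cancel]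
  rw [e1 a ha, e1 b hb] at h
  have h1 : b ^ (d - 1) ≤ M * a ^ (d - 1) := by
    have : 0 < a * b := by positivity
    exact le_of_mul_le_mul_right (by linarith) this
  have h2 := Real.rpow_le_rpow (by positivity) h1 (inv_nonneg.2 hd'.le)
  rwa [Real.mul_rpow hM.le (by positivity), Real.rpow_rpow_inv hb.le hd'.ne',
    Real.rpow_rpow_inv ha.le hd'.ne'] at h2

/-- Consecutive returns to a critical point are comparable. -/
lemma gap_le_neg_gap_of_powerLaw (he : OrderedAsRotation e ρ) (hc : Convergents ρ q p q' p')
    (hcri : CrossRatioInequality e q p q' B) (hB : 1 ≤ B) (hA1 : 1 ≤ A)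
    (hA : ReturnsComparable e q p A) (hA' : ReturnsComparable e q' p' A) {c d K : ℝ}
    (hd : 1 < d) (hK : 0 < K) (hpow : PowerLaw e c d K) :
    gap e q p c ≤ (A ^ 2 * (1 + A) ^ 2 * B * K) ^ (d - 1)⁻¹ * -gap e q' p' c := by
  have hgt : ∀ x, x < orb e q p x := fun x => he.lt_orb q p hc.pos x
  have hlt : ∀ x, orb e q' p' x < x := fun x => sub_neg.1 (hc.gap_neg he x)
  have hδ : 0 < -gap e q' p' c := neg_pos.2 (hc.gap_neg he c)
  have hl := hc.gap_pos he c
  refine rpow_le_of_mul_rpow_le hδ hl (by positivity) hd ?_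
  have hcomm : ∀ (s t : ℤ) x, orb e s t (e x) = e (orb e s t x) := fun s t x => by
    rw [← orb_one_zero e x, ← orb_one_zero e (orb e s t x), he.orb_orb, he.orb_orb, add_comm,
      add_comm t]
  have hm : ∀ x, orb e (q' - 1) p' (e x) = orb e q' p' x := fun x => by
    rw [← orb_one_zero e x, he.orb_orb, sub_add_cancel, add_zero]
  have hq := hc.one_le
  have hqq := hc.le
  have h1 := hcri.crossRatio_le hB he hc 1 (a := e (orb e q' p' c)) (b := e c)
    (by rw [hcomm]; exact e.monotone (hc.orb_neg_le he c)) (e.strictMono (hlt c)) (m := q' - 1) p'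
    (by omega) (by push_cast; omega)
  rw [hm, hm, hcomm, hcomm, pow_one] at h1
  have h2 := crossRatio_mul_le_left (e.strictMono (hlt c)) (e.strictMono (hgt c))
    (e.strictMono (hgt _))
  set X := crossRatio (e (orb e q' p' c)) (e c) (e (orb e q p c)) (e (orb e q p (orb e q p c)))
  have hone : ∀ x, orb e q p x < x + 1 := fun x => by
    have := he.orb_lt_orb (q := q) (p := p) (q' := 0) (p' := -1)
      (by push_cast; linarith [hc.lt_one]) x
    simpa [orb] using this
  have hone' : ∀ x, x - 1 < orb e q' p' x := fun x => by
    have := he.orb_lt_orb (q := 0) (p := 1) (q' := q') (p' := p')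
      (by push_cast; linarith [hc.add_pos, hc.lt_one]) x
    simpa [orb] using this
  have h3 := hpow (orb e q' p' c) (orb e q p c)
    (by rw [abs_le]; constructor <;> linarith [hlt c, hone' c])
    (by rw [abs_le]; constructor <;> linarith [hgt c, hone c])
  rw [abs_of_neg (sub_neg.2 (e.strictMono (hlt c))), abs_of_neg (sub_neg.2 (hlt c)),
    abs_of_pos (sub_pos.2 (hgt c)), abs_of_pos (sub_pos.2 (e.strictMono (hgt c)))] at h3
  change _ * gap e q p c ^ d ≤ K * ((-gap e q' p' c) ^ d * _) at h3
  set l := gap e q p c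
  set δ := -gap e q' p' c with hδd
  have hX : X * l ^ d ≤ K * δ ^ d := by
    have h4 : 0 < e (orb e q p c) - e c := sub_pos.2 (e.strictMono (hgt c))
    refine le_of_mul_le_mul_right ?_ h4
    calc X * l ^ d * (e (orb e q p c) - e c) = X * (e (orb e q p c) - e c) * l ^ d := by ring
      _ ≤ (e c - e (orb e q' p' c)) * l ^ d := by gcongr
      _ ≤ _ := by linarith
  have h5 := hA'.neg_gap_le hc he c
  have h6 := hA.neg_gap_le_crossRatio hA1 hc he (orb e q' p' c)
  have h7 := hA.gap_orb_le hc he c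
  have h8 : δ ≤ A ^ 2 * (1 + A) ^ 2 * B * l * X := by
    set Y := crossRatio (orb e q' p' (orb e q' p' c)) (orb e q' p' c)
      (orb e q p (orb e q' p' c)) (orb e q p (orb e q p (orb e q' p' c)))
    have hY : 0 ≤ Y := (crossRatio_pos (hlt _) (hgt _) (hgt _)).le
    calc δ ≤ A * ((1 + A) ^ 2 * gap e q p (orb e q' p' c) * Y) := by
          refine h5.trans ?_
          gcongr
      _ ≤ A * ((1 + A) ^ 2 * (A * l) * (B * X)) := by gcongr
      _ = _ := by ring
  calc δ * l ^ d ≤ A ^ 2 * (1 + A) ^ 2 * B * l * X * l ^ d := by gcongr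
    _ = A ^ 2 * (1 + A) ^ 2 * B * l * (X * l ^ d) := by ring
    _ ≤ A ^ 2 * (1 + A) ^ 2 * B * l * (K * δ ^ d) := by gcongr
    _ = _ := by ring

/-- Consecutive returns are comparable along the orbit of a critical point. -/
lemma gap_orb_le_neg_gap_orb (he : OrderedAsRotation e ρ) (hc : Convergents ρ q p q' p')
    (hcri : CrossRatioInequality e q p q' B) (hB : 1 ≤ B) (hA1 : 1 ≤ A)
    (hA : ReturnsComparable e q p A) (hA' : ReturnsComparable e q' p' A) {c T : ℝ}
    (hT : gap e q p c ≤ T * -gap e q' p' c) {j : ℤ} (k : ℤ) (hj : 0 ≤ j) (hjq : j ≤ 2 * q') :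
    gap e q p (orb e j k c) ≤
      T * A ^ 4 * (1 + A) ^ 2 * B ^ 2 * -gap e q' p' (orb e j k c) := by
  have hgt : ∀ x, x < orb e q p x := fun x => he.lt_orb q p hc.pos x
  have hlt : ∀ x, orb e q' p' x < x := fun x => sub_neg.1 (hc.gap_neg he x)
  have hδ : 0 < -gap e q' p' c := neg_pos.2 (hc.gap_neg he c)
  have hl := hc.gap_pos he c
  have hT0 : 0 < T := pos_of_mul_pos_left (hl.trans_le hT) hδ.le
  set x := orb e j k c with hx
  set c₂ := orb e q' p' (orb e q' p' c) with hc₂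
  have hm : orb e (2 * q' - j) (2 * p' - k) x = c₂ := by
    rw [hx, hc₂, he.orb_orb, he.orb_orb]
    congr 1 <;> ring
  have h1 := hcri.crossRatio_le hB he hc 2 (hc.orb_neg_le he x) (hlt x) (m := 2 * q' - j)
    (2 * p' - k) (by omega) (by push_cast; omega)
  rw [show orb e (2 * q' - j) (2 * p' - k) (orb e q' p' x) = orb e q' p' c₂ by
    rw [← hm, he.orb_orb (2 * q' - j) _ q' p' x, he.orb_orb q' p' (2 * q' - j) _ x,
      add_comm q', add_comm p'], hm] at h1
  have h2 := crossRatio_mul_le_left (hlt x) (hgt x) (hgt _)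
  have hX := (crossRatio_pos (hlt x) (hgt x) (hgt _)).le
  set X := crossRatio (orb e q' p' x) x (orb e q p x) (orb e q p (orb e q p x))
  have h3 := hA'.neg_gap_le hc he c
  have h4 := hA'.neg_gap_le hc he (orb e q' p' c)
  have h5 := hA.gap_orb_le hc he c
  have h6 := hA.gap_orb_le hc he (orb e q' p' c)
  have h7 := hA.neg_gap_le_crossRatio hA1 hc he c₂
  rw [← hc₂] at h4 h6
  set l := gap e q p c
  have h8 : l ≤ T * A ^ 4 * (1 + A) ^ 2 * B ^ 2 * X * l := by
    set Y := crossRatio (orb e q' p' c₂) c₂ (orb e q p c₂) (orb e q p (orb e q p c₂))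
    have hY : 0 ≤ Y := (crossRatio_pos (hlt _) (hgt _) (hgt _)).le
    calc l ≤ T * -gap e q' p' c := hT
      _ ≤ T * (A * (A * ((1 + A) ^ 2 * gap e q p c₂ * Y))) := by
        gcongr
        refine h3.trans ?_
        gcongr
        exact h4.trans (by gcongr)
      _ ≤ T * (A * (A * ((1 + A) ^ 2 * (A * (A * l)) * (B ^ 2 * X)))) := by
        gcongr
        exact h6.trans (by gcongr)
      _ = _ := by ring
  have h9 : 1 ≤ T * A ^ 4 * (1 + A) ^ 2 * B ^ 2 * X := by
    by_contra! hlt'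
    nlinarith
  calc gap e q p x ≤ T * A ^ 4 * (1 + A) ^ 2 * B ^ 2 * X * gap e q p x :=
        le_mul_of_one_le_left (hc.gap_pos he x).le h9
    _ = T * A ^ 4 * (1 + A) ^ 2 * B ^ 2 * (X * gap e q p x) := by ring
    _ ≤ T * A ^ 4 * (1 + A) ^ 2 * B ^ 2 * -gap e q' p' x := by
      gcongr
      refine h2.trans (le_of_eq ?_)
      rw [gap, neg_sub]

end Convergents

lemma CrossRatioControl.mirror {e : ℝ ≃o ℝ} {C : Finset ℝ} {K : ℝ}
    (h : CrossRatioControl e C K) :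
    CrossRatioControl (mirror e) (C.image fun c => -c) K := by
  intro a b c d hab hbc hcd hd
  obtain ⟨h1, h2⟩ := h (-d) (-c) (-b) (-a) (by linarith) (by linarith) (by linarith) (by linarith)
  simp only [mirror_apply]
  rw [crossRatio_neg, crossRatio_reverse, ← crossRatio_neg a, crossRatio_reverse (-d)]
  refine ⟨h1, fun hc => ?_⟩
  rw [show d - a = -a - -d by ring]
  refine h2 fun t ht c' hc' k htk => ?_
  refine hc (-t) ⟨by linarith [ht.2], by linarith [ht.1]⟩ (-c') (Finset.mem_image_of_mem _ hc')
    (-k) ?_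
  rw [htk]
  push_cast
  ring

lemma PowerLaw.mirror {e : ℝ ≃o ℝ} {c d K : ℝ} (h : PowerLaw e c d K) :
    PowerLaw (mirror e) (-c) d K := by
  have key : ∀ x y : ℝ, |(-x) - y| = |x - -y| := fun x y => by
    rw [← abs_neg]; congr 1; ring
  intro x y hx hy
  rw [← key] at hx hy
  have := h (-x) (-y) hx hy
  simp only [mirror_apply, neg_neg]
  rwa [key, key, ← abs_neg (e (-x) - e c), ← abs_neg (e (-y) - e c), neg_sub', neg_sub'] at this

lemma CrossRatioInequality.mono {e : ℝ ≃o ℝ} {q p q' : ℤ} {B B' : ℝ} (hB : B ≤ B')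
    (h : CrossRatioInequality e q p q' B) : CrossRatioInequality e q p q' B' := by
  intro y a b c d ha hab hbc hcd hd m k hm hmq
  refine (h y a b c d ha hab hbc hcd hd m k hm hmq).trans ?_
  have := (crossRatio_pos hab hbc hcd).le
  gcongr

/-- The real bounds, in terms of return distances: returns of nearby points are comparable at all
levels, and so are returns at consecutive levels along critical orbits. -/
lemma exists_return_bounds {f : ℝ → ℝ} {C : Finset ℝ} {dc : ℝ → ℝ} {ρ : ℝ}
    (hf : GoodMap f C dc ρ) :
    ∃ e : ℝ ≃o ℝ, (∀ x, e x = f x) ∧ OrderedAsRotation e ρ ∧ ∃ A : ℝ, 1 ≤ A ∧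
      (∀ n, ReturnsComparable e (qden ρ n) (pnum ρ n) A) ∧
      ∀ n, ∀ c ∈ C, ∀ j : ℤ, 0 ≤ j → j ≤ 2 * qden ρ (n + 1) →
        |gap e (qden ρ n) (pnum ρ n) (orb e j 0 c)| ≤
          A * |gap e (qden ρ (n + 1)) (pnum ρ (n + 1)) (orb e j 0 c)| := by
  obtain ⟨hm, hrot, hirr, h01⟩ := hf
  obtain ⟨e, hef, he⟩ := exists_orderedAsRotation hm.1 hrot hirr
  obtain rfl : (e : ℝ → ℝ) = f := funext hef
  refine ⟨e, hef, he, ?_⟩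
  obtain ⟨K, hK, hcr⟩ := hm.exists_crossRatio_map_le
  have hctrl : CrossRatioControl e C K := fun a b c d hab hbc hcd hd => by
    obtain ⟨h1, h2⟩ := hcr a b c d hab hbc hcd hd
    refine ⟨h1, fun h => h2 fun t ht h0 => ?_⟩
    obtain ⟨c', hc', k, hk⟩ := (hm.2.2.2.1 t).1 h0
    exact h t ht c' hc' k hk
  obtain ⟨B₁, hB₁, hcri₁⟩ := hctrl.exists_inequality hK he
  obtain ⟨B₂, hB₂, hcri₂⟩ := hctrl.mirror.exists_inequality hK he.mirror
  set B := max B₁ B₂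
  have hB : 1 ≤ B := hB₁.trans (le_max_left _ _)
  set A := (4 * B ^ 12 * B * (1 + 2 * (4 * B ^ 12)) ^ 2) ^ 3 with hAdef
  have hA1 : 1 ≤ A := by
    have h1 : 1 ≤ B ^ 12 := one_le_pow₀ hB
    have h2 : 1 ≤ 4 * B ^ 12 * B := by nlinarith
    have h3 : 1 ≤ (1 + 2 * (4 * B ^ 12)) ^ 2 := one_le_pow₀ (by linarith)
    exact one_le_pow₀ (by nlinarith)
  have hconv := fun n => (convergents_qden_pnum hirr h01 n).1
  have hret : ∀ n, ReturnsComparable e (qden ρ n) (pnum ρ n) A := by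
    intro n
    have hc := hconv n
    rcases neg_one_pow_eq_or ℤ n with hs | hs <;> rw [hs] at hc
    · simp only [Int.cast_one, one_mul] at hc
      exact ((hcri₁ _ _ _ _ hc).mono (le_max_left _ _)).returnsComparable hB he hc rfl
    · simp only [Int.cast_neg, Int.cast_one, neg_mul, one_mul] at hc
      have := ((hcri₂ _ _ _ _ hc).mono (le_max_right _ _)).returnsComparable hB he.mirror hc rfl
      have := this.mirror
      rwa [mirror_mirror, neg_neg] at this
  have hcrit : ∀ c ∈ C, ∃ E : ℝ, ∀ n, ∀ j : ℤ, 0 ≤ j → j ≤ 2 * qden ρ (n + 1) →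
      |gap e (qden ρ n) (pnum ρ n) (orb e j 0 c)| ≤
        E * |gap e (qden ρ (n + 1)) (pnum ρ (n + 1)) (orb e j 0 c)| := by
    intro c hcC
    obtain ⟨M, hM, hpow⟩ := hm.exists_power_law hcC
    have hd : 1 < dc c := (hm.2.2.2.2 c hcC).1
    have hpow' : PowerLaw e c (dc c) M := hpow
    refine ⟨(A ^ 2 * (1 + A) ^ 2 * B * M) ^ (dc c - 1)⁻¹ * A ^ 4 * (1 + A) ^ 2 * B ^ 2, ?_⟩
    intro n j hj hjq
    have hc := hconv n
    rcases neg_one_pow_eq_or ℤ n with hs | hs <;> rw [hs] at hc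
    · simp only [Int.cast_one, one_mul] at hc
      have hcri := (hcri₁ _ _ _ _ hc).mono (le_max_left _ B₂)
      have h := gap_orb_le_neg_gap_orb he hc hcri hB hA1 (hret n) (hret (n + 1))
        (gap_le_neg_gap_of_powerLaw he hc hcri hB hA1 (hret n) (hret (n + 1)) hd hM hpow')
        0 hj hjq
      rwa [abs_of_pos (hc.gap_pos he _), abs_of_neg (hc.gap_neg he _)]
    · simp only [Int.cast_neg, Int.cast_one, neg_mul, one_mul] at hc
      have hcri := (hcri₂ _ _ _ _ hc).mono (le_max_right B₁ _)
      have h := gap_orb_le_neg_gap_orb he.mirror hc hcri hB hA1 (hret n).mirror (hret (n + 1)).mirror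
        (gap_le_neg_gap_of_powerLaw he.mirror hc hcri hB hA1 (hret n).mirror (hret (n + 1)).mirror
          hd hM hpow'.mirror)
        0 hj hjq
      have h1 := hc.gap_pos he.mirror (orb (mirror e) j 0 (-c))
      have h2 := hc.gap_neg he.mirror (orb (mirror e) j 0 (-c))
      simp only [orb_mirror, gap_mirror, neg_neg, neg_zero] at h h1 h2
      rwa [abs_of_neg (neg_pos.1 h1), abs_of_pos (neg_lt_zero.1 h2)]
  choose! E hE using hcrit
  obtain ⟨E₀, hE₀⟩ := (C.image E).exists_le
  refine ⟨max A E₀, hA1.trans (le_max_left _ _), fun n => (hret n).mono (le_max_left _ _), ?_⟩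
  intro n c hcC j hj hjq
  refine (hE c hcC n j hj hjq).trans ?_
  gcongr
  exact (hE₀ _ (Finset.mem_image_of_mem _ hcC)).trans (le_max_right _ _)

/-- The signed rotation angle `qₙρ - pₙ` of the `n`-th closest return. -/
def returnAngle (ρ : ℝ) (n : ℕ) : ℝ := (qden ρ n : ℤ) * ρ - (pnum ρ n : ℤ)

section ReturnAngle

variable {ρ : ℝ}

lemma returnAngle_add_two (ρ : ℝ) (n : ℕ) :
    returnAngle ρ (n + 2) = cfA ρ (n + 1) * returnAngle ρ (n + 1) + returnAngle ρ n := by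
  simp only [returnAngle, qden, pnum]
  push_cast
  ring

lemma returnAngle_sign (hirr : Irrational ρ) (h01 : ρ ∈ Ioo (0 : ℝ) 1) (n : ℕ) :
    (0 < returnAngle ρ n ∧ returnAngle ρ (n + 1) < 0 ∧
        0 < returnAngle ρ n + returnAngle ρ (n + 1)) ∨
      returnAngle ρ n < 0 ∧ 0 < returnAngle ρ (n + 1) ∧
        returnAngle ρ n + returnAngle ρ (n + 1) < 0 := by
  have h := (convergents_qden_pnum hirr h01 n).1
  have h1 := h.pos
  have h2 := h.neg
  have h3 := h.add_pos
  simp only [returnAngle]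
  rcases neg_one_pow_eq_or ℤ n with hs | hs <;> rw [hs] at h1 h2 h3 <;> push_cast at *
  · exact Or.inl ⟨by linarith, by linarith, by linarith⟩
  · exact Or.inr ⟨by linarith, by linarith, by linarith⟩

lemma abs_returnAngle_le (hirr : Irrational ρ) (h01 : ρ ∈ Ioo (0 : ℝ) 1) (n : ℕ)
    {j k : ℤ} (hj : |j| < qden ρ (n + 1)) (hjk : j ≠ 0 ∨ k ≠ 0) :
    |returnAngle ρ n| ≤ |j * ρ - k| := by
  have h := (convergents_qden_pnum hirr h01 n).1
  have h1 := h.pos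
  have key := h.best_approx (k := (-1) ^ n * k) hj
    (hjk.imp_right fun hk => mul_ne_zero (pow_ne_zero _ (by norm_num)) hk)
  simp only [returnAngle]
  rcases neg_one_pow_eq_or ℤ n with hs | hs <;> rw [hs] at h1 key <;> push_cast at *
  · rw [one_mul, one_mul, one_mul] at *
    rwa [abs_of_pos h1]
  · rw [abs_of_neg (by linarith), ← abs_neg (_ - _)]
    convert key using 1
    · ring
    · congr 1; ring

lemma qden_le_succ (hirr : Irrational ρ) (h01 : ρ ∈ Ioo (0 : ℝ) 1) (n : ℕ) :
    qden ρ n ≤ qden ρ (n + 1) := by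
  exact_mod_cast (convergents_qden_pnum hirr h01 n).1.le

lemma qden_add_le (hirr : Irrational ρ) (n : ℕ) : qden ρ n + qden ρ (n + 1) ≤ qden ρ (n + 2) := by
  rw [qden, add_comm]
  exact Nat.add_le_add_right (Nat.le_mul_of_pos_left _ (one_le_cfA hirr _)) _

lemma abs_returnAngle_add_le (hirr : Irrational ρ) (h01 : ρ ∈ Ioo (0 : ℝ) 1)
    (n : ℕ) :
    |returnAngle ρ (n + 1)| + |returnAngle ρ (n + 2)| ≤ |returnAngle ρ n| := by
  have ha : (1 : ℝ) ≤ cfA ρ (n + 1) := by exact_mod_cast one_le_cfA hirr (n + 1)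
  have h2 := returnAngle_add_two ρ n
  rcases returnAngle_sign hirr h01 n with h | h <;>
    rcases returnAngle_sign hirr h01 (n + 1) with h' | h'
  · linarith [h.2.1, h'.1]
  · rw [abs_of_pos h.1, abs_of_neg h.2.1, abs_of_pos h'.2.1]
    nlinarith [h.2.1]
  · rw [abs_of_neg h.1, abs_of_pos h.2.1, abs_of_neg h'.2.1]
    nlinarith [h.2.1]
  · linarith [h.2.1, h'.1]

/-- No rotation by a time between `-q_{n+2}` and `q_{n+1} + q_{n+2}` lands strictly between a point
and its `(n+1)`-st closest return. -/
lemma not_strictBetween_returnAngle (hirr : Irrational ρ) (h01 : ρ ∈ Ioo (0 : ℝ) 1)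
    (n : ℕ) {r k : ℤ} (hr : -qden ρ (n + 2) < r)
    (hr' : r < qden ρ (n + 1) + qden ρ (n + 2)) :
    ¬ (min 0 (returnAngle ρ (n + 1)) < r * ρ - k ∧
      r * ρ - k < max 0 (returnAngle ρ (n + 1))) := by
  intro ⟨h1, h2⟩
  have h3 := qden_le_succ hirr h01 (n + 1)
  have hne : ∀ {j l : ℤ}, (j : ℝ) * ρ - l ≠ 0 → j ≠ 0 ∨ l ≠ 0 := fun h => by
    by_contra! h0
    simp [h0.1, h0.2] at h
  have hadd := abs_returnAngle_add_le hirr h01 n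
  rcases lt_or_ge r (qden ρ (n + 2)) with hlt | hge
  · rcases returnAngle_sign hirr h01 (n + 1) with ⟨hs, -, -⟩ | ⟨hs, -, -⟩
    · rw [min_eq_left hs.le] at h1
      rw [max_eq_right hs.le] at h2
      have := abs_returnAngle_le hirr h01 (n + 1) (abs_lt.2 ⟨hr, hlt⟩) (hne h1.ne')
      rw [abs_of_pos hs, abs_of_pos h1] at this
      linarith
    · rw [min_eq_right hs.le] at h1
      rw [max_eq_left hs.le] at h2
      have := abs_returnAngle_le hirr h01 (n + 1) (abs_lt.2 ⟨hr, hlt⟩) (hne h2.ne)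
      rw [abs_of_neg hs, abs_of_neg h2] at this
      linarith
  · have hj : |r - qden ρ (n + 2)| < (qden ρ (n + 1) : ℤ) := by
      rw [abs_of_nonneg (by omega)]; omega
    have heq : ((r - qden ρ (n + 2) : ℤ) : ℝ) * ρ - (k - pnum ρ (n + 2) : ℤ) =
        (r * ρ - k) - returnAngle ρ (n + 2) := by
      simp only [returnAngle]; push_cast; ring
    rcases returnAngle_sign hirr h01 (n + 1) with ⟨hs, hs', -⟩ | ⟨hs, hs', -⟩
    · rw [min_eq_left hs.le] at h1
      rw [max_eq_right hs.le] at h2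
      have hpos : 0 < (r * ρ - k) - returnAngle ρ (n + 2) := by linarith
      have := abs_returnAngle_le hirr h01 n hj (k := k - pnum ρ (n + 2))
        (hne (by rw [heq]; exact hpos.ne'))
      rw [heq, abs_of_pos hpos] at this
      rw [abs_of_pos hs, abs_of_neg hs'] at hadd
      linarith
    · rw [min_eq_right hs.le] at h1
      rw [max_eq_left hs.le] at h2
      have hneg : (r * ρ - k) - returnAngle ρ (n + 2) < 0 := by linarith
      have := abs_returnAngle_le hirr h01 n hj (k := k - pnum ρ (n + 2))
        (hne (by rw [heq]; exact hneg.ne))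
      rw [heq, abs_of_neg hneg] at this
      rw [abs_of_neg hs, abs_of_pos hs'] at hadd
      linarith

end ReturnAngle

/-- An interval between `x` and `y` that does not have `v` in its interior lies on one side of
`v`. -/
lemma sub_le_max_abs_of_notMem_Ioo {x y v a b : ℝ} (hv : v ∈ uIcc x y) (ha : min x y ≤ a)
    (hb : b ≤ max x y) (h : v ∉ Ioo a b) : b - a ≤ max |v - x| |y - v| := by
  rw [le_max_iff]
  rcases le_total x y with hxy | hxy
  · rw [uIcc_of_le hxy] at hv
    rw [min_eq_left hxy] at ha
    rw [max_eq_right hxy] at hb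
    rw [abs_of_nonneg (sub_nonneg.2 hv.1), abs_of_nonneg (sub_nonneg.2 hv.2)]
    by_contra! h0
    exact h ⟨by linarith, by linarith⟩
  · rw [uIcc_of_ge hxy] at hv
    rw [min_eq_right hxy] at ha
    rw [max_eq_left hxy] at hb
    rw [abs_of_nonpos (sub_nonpos.2 hv.2), abs_of_nonpos (sub_nonpos.2 hv.1)]
    by_contra! h0
    exact h ⟨by linarith, by linarith⟩

lemma abs_sub_eq_add_of_mem_uIcc {x y v : ℝ} (hv : v ∈ uIcc x y) :
    |y - x| = |v - x| + |y - v| := by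
  rcases mem_uIcc.1 hv with hv | hv
  · rw [abs_of_nonneg, abs_of_nonneg, abs_of_nonneg] <;> linarith
  · rw [abs_of_nonpos, abs_of_nonpos, abs_of_nonpos] <;> linarith

section Atoms

variable {e : ℝ ≃o ℝ} {ρ : ℝ}

/-- The `n`-th closest return of `x` under the lift `e`. -/
def ret (e : ℝ ≃o ℝ) (ρ : ℝ) (n : ℕ) (x : ℝ) : ℝ := orb e (qden ρ n) (pnum ρ n) x

lemma iterate_eq_orb (e : ℝ ≃o ℝ) (n : ℕ) (x : ℝ) : e^[n] x = orb e n 0 x := by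
  simp only [orb, Int.cast_zero, sub_zero, zpow_natCast]
  induction n generalizing x with
  | zero => rfl
  | succ n ih => rw [Function.iterate_succ_apply, ih, pow_succ]; rfl

lemma retPt_eq (e : ℝ ≃o ℝ) (ρ x : ℝ) (n : ℕ) : retPt e ρ x n = ret e ρ n x := by
  rw [retPt, iterate_eq_orb, ret]
  simp [orb]

lemma OrderedAsRotation.iterate_retPt (he : OrderedAsRotation e ρ) (i n : ℕ) (x : ℝ) :
    e^[i] (retPt e ρ x n) = ret e ρ n (orb e i 0 x) := by
  rw [retPt_eq, iterate_eq_orb, ret, ret, he.orb_orb, he.orb_orb, add_comm, add_comm (0 : ℤ)]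

/-- The atom with index `I` has endpoints `x` and its `M`-th return, where `x` is the image of the
critical point at time `t`. -/
lemma OrderedAsRotation.exists_atom_endpoints (he : OrderedAsRotation e ρ) (c : ℝ) (n : ℕ)
    (I : AtomIdx ρ n) : ∃ t M : ℕ,
      (t < qden ρ (n + 1) ∧ M = n ∨ t < qden ρ n ∧ M = n + 1) ∧
      atomL e ρ c n I = min (orb e t 0 c) (ret e ρ M (orb e t 0 c)) ∧
      atomR e ρ c n I = max (orb e t 0 c) (ret e ρ M (orb e t 0 c)) := by
  rcases I with ⟨i, hi⟩ | ⟨j, hj⟩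
  · exact ⟨i, n, Or.inl ⟨hi, rfl⟩, by simp only [atomL, he.iterate_retPt, iterate_eq_orb],
      by simp only [atomR, he.iterate_retPt, iterate_eq_orb]⟩
  · exact ⟨j, n + 1, Or.inr ⟨hj, rfl⟩, by simp only [atomL, he.iterate_retPt, iterate_eq_orb],
      by simp only [atomR, he.iterate_retPt, iterate_eq_orb]⟩

lemma OrderedAsRotation.orb_mem_uIcc (he : OrderedAsRotation e ρ) {q p q₁ p₁ q₂ p₂ : ℤ}
    (h : q * ρ - p ∈ uIcc (q₁ * ρ - p₁) (q₂ * ρ - p₂)) (x : ℝ) :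
    orb e q p x ∈ uIcc (orb e q₁ p₁ x) (orb e q₂ p₂ x) := by
  rw [mem_uIcc] at *
  exact h.imp (fun h => ⟨he.orb_le_orb h.1 x, he.orb_le_orb h.2 x⟩)
    (fun h => ⟨he.orb_le_orb h.1 x, he.orb_le_orb h.2 x⟩)

/-- The return bounds produced by `exists_return_bounds` at a single critical point. -/
structure ReturnBounds (e : ℝ ≃o ℝ) (ρ A c : ℝ) : Prop where
  one_le : 1 ≤ A
  irrational : Irrational ρ
  mem_Ioo : ρ ∈ Ioo (0 : ℝ) 1
  ordered : OrderedAsRotation e ρ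
  comparable : ∀ n, ReturnsComparable e (qden ρ n) (pnum ρ n) A
  le_succ : ∀ n, ∀ j : ℤ, 0 ≤ j → j ≤ 2 * qden ρ (n + 1) →
    |gap e (qden ρ n) (pnum ρ n) (orb e j 0 c)| ≤
      A * |gap e (qden ρ (n + 1)) (pnum ρ (n + 1)) (orb e j 0 c)|

namespace ReturnBounds

variable {A c : ℝ}

lemma le_succ' (h : ReturnBounds e ρ A c) (n : ℕ) {j : ℤ} (k : ℤ) (hj : 0 ≤ j)
    (hj' : j ≤ 2 * qden ρ (n + 1)) :
    |gap e (qden ρ n) (pnum ρ n) (orb e j k c)| ≤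
      A * |gap e (qden ρ (n + 1)) (pnum ρ (n + 1)) (orb e j k c)| := by
  have hk : orb e j 0 c = orb e j k c + k := by simp [orb]
  have := h.le_succ n j hj hj'
  rwa [hk, h.ordered.gap_add_int, h.ordered.gap_add_int] at this

/-- The length of an atom is comparable to the return distance of each of its endpoints. -/
lemma gap_comparable_atomLen (h : ReturnBounds e ρ A c) (n : ℕ) (I : AtomIdx ρ n) {P : ℝ}
    (hP : P ∈ ({atomL e ρ c n I, atomR e ρ c n I} : Set ℝ)) :
    |gap e (qden ρ n) (pnum ρ n) P| ≤ A ^ 3 * atomLen e ρ c n I ∧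
      atomLen e ρ c n I ≤ A ^ 3 * |gap e (qden ρ n) (pnum ρ n) P| := by
  have hA := h.one_le
  have hA3 : A ≤ A ^ 3 := le_self_pow₀ hA (by norm_num)
  obtain ⟨t, M, ht, hL, hR⟩ := h.ordered.exists_atom_endpoints c n I
  rw [atomLen, hL, hR, max_sub_min_eq_abs]
  rw [hL, hR] at hP
  set x := orb e t 0 c with hx
  replace hP : P = x ∨ P = ret e ρ M x := by
    rcases le_total x (ret e ρ M x) with hle | hle
    · simpa [hle] using hP
    · simpa [hle, or_comm] using hP
  rcases ht with ⟨-, rfl⟩ | ⟨ht, rfl⟩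
  · have hPm : P ∈ uIcc x (ret e ρ M x) := by rcases hP with rfl | rfl <;> simp
    obtain ⟨h1, h2⟩ := h.comparable M x P hPm
    have h3 : |ret e ρ M x - x| = |gap e (qden ρ M) (pnum ρ M) x| := rfl
    rw [h3]
    exact ⟨h2.trans (by gcongr), h1.trans (by gcongr)⟩
  · set g := fun y => |gap e (qden ρ n) (pnum ρ n) y| with hg
    change g P ≤ _ ∧ _ ≤ _ * g P
    set y := orb e (-qden ρ n) (-pnum ρ n) x with hy
    have hyx : orb e (qden ρ n) (pnum ρ n) y = x := by
      rw [hy, h.ordered.orb_orb]; simp [orb_zero_zero]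
    have hPm : ∀ z, z = x ∨ z = ret e ρ (n + 1) x → z ∈ uIcc y x := by
      rintro z (rfl | rfl)
      · simp
      · have := h.ordered.orb_mem_uIcc (q := qden ρ (n + 1)) (p := pnum ρ (n + 1))
          (q₁ := -qden ρ n) (p₁ := -pnum ρ n) (q₂ := 0) (p₂ := 0) (by
            have hs := returnAngle_sign h.irrational h.mem_Ioo n
            simp only [returnAngle] at hs
            push_cast at hs ⊢
            rw [mem_uIcc]
            rcases hs with hs | hs
            · left; constructor <;> linarith [hs.1, hs.2.1, hs.2.2]
            · right; constructor <;> linarith [hs.1, hs.2.1, hs.2.2]) x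
        rwa [orb_zero_zero] at this
    have hcomp : ∀ z, z = x ∨ z = ret e ρ (n + 1) x → g y ≤ A * g z ∧ g z ≤ A * g y :=
      fun z hz => h.comparable n y z (by rw [hyx]; exact hPm z hz)
    have hlen : |ret e ρ (n + 1) x - x| ≤ g y := by
      have := abs_sub_right_of_mem_uIcc (hPm _ (Or.inr rfl))
      rw [abs_sub_comm]
      simpa only [hg, gap, hyx] using this
    have hsucc : g x ≤ A * |ret e ρ (n + 1) x - x| :=
      h.le_succ n t (by positivity) (by
        have := qden_le_succ h.irrational h.mem_Ioo n
        omega)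
    have hgP := hcomp P hP
    have hg0 : 0 ≤ g P := abs_nonneg _
    refine ⟨?_, hlen.trans (hgP.1.trans (by gcongr))⟩
    calc g P ≤ A * (A * (A * |ret e ρ (n + 1) x - x|)) := by
          refine hgP.2.trans ?_
          gcongr
          refine (hcomp x (Or.inl rfl)).1.trans ?_
          gcongr
      _ = _ := by ring

/-- Adjacent atoms are comparable. -/
lemma atomLen_le_of_adjacent (h : ReturnBounds e ρ A c) {n : ℕ} {I J : AtomIdx ρ n}
    (hIJ : AdjacentAtoms e ρ c n I J) :
    atomLen e ρ c n I ≤ A ^ 6 * atomLen e ρ c n J ∧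
      atomLen e ρ c n J ≤ A ^ 6 * atomLen e ρ c n I := by
  obtain ⟨-, P, hP, Q, hQ, m, rfl⟩ := hIJ
  have h1 := h.gap_comparable_atomLen n I hP
  have h2 := h.gap_comparable_atomLen n J hQ
  rw [h.ordered.gap_add_int] at h1
  have hA : 0 ≤ A ^ 3 := pow_nonneg (by linarith [h.one_le]) _
  constructor
  · calc _ ≤ A ^ 3 * (A ^ 3 * atomLen e ρ c n J) := h1.2.trans (by gcongr; exact h2.1)
      _ = _ := by ring
  · calc _ ≤ A ^ 3 * (A ^ 3 * atomLen e ρ c n I) := h2.2.trans (by gcongr; exact h1.1)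
      _ = _ := by ring

/-- Orbit points at times less than `q_{n+2} + q_{n+3}` do not lie inside atoms of level `n+2`. -/
lemma orb_notMem_Ioo_atom (h : ReturnBounds e ρ A c) (n : ℕ) (I : AtomIdx ρ (n + 2)) {t k : ℤ}
    (ht : 0 ≤ t) (ht' : t < qden ρ (n + 2) + qden ρ (n + 3)) :
    orb e t k c ∉ Ioo (atomL e ρ c (n + 2) I) (atomR e ρ c (n + 2) I) := by
  obtain ⟨s, M, hs, hL, hR⟩ := h.ordered.exists_atom_endpoints c (n + 2) I
  obtain ⟨M, rfl, hs1, hs2⟩ : ∃ N, M = N + 1 ∧ s < qden ρ (N + 2) ∧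
      qden ρ (n + 2) + qden ρ (n + 3) ≤ qden ρ (N + 1) + qden ρ (N + 2) := by
    rcases hs with ⟨hs, rfl⟩ | ⟨hs, rfl⟩
    · exact ⟨n + 1, rfl, hs, le_rfl⟩
    · have h1 : qden ρ (n + 2) + qden ρ (n + 3) ≤ qden ρ (n + 4) :=
        qden_add_le h.irrational (n + 2)
      exact ⟨n + 2, rfl, by rw [show n + 2 + 2 = n + 4 from rfl]; omega,
        by rw [show n + 2 + 1 = n + 3 from rfl, show n + 2 + 2 = n + 4 from rfl]; omega⟩
  rw [hL, hR]
  intro ⟨h1, h2⟩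
  refine not_strictBetween_returnAngle h.irrational h.mem_Ioo M (r := t - s) (k := k)
    (by omega) (by omega) ?_
  rw [ret, h.ordered.orb_orb] at h1 h2
  rw [min_lt_iff] at h1 ⊢
  rw [lt_max_iff] at h2 ⊢
  simp only [returnAngle]
  constructor
  · refine h1.imp (fun h1 => ?_) (fun h1 => ?_) <;>
      have := h.ordered.lt_of_orb_lt_orb h1 <;> push_cast at this ⊢ <;> linarith
  · refine h2.imp (fun h1 => ?_) (fun h1 => ?_) <;>
      have := h.ordered.lt_of_orb_lt_orb h1 <;> push_cast at this ⊢ <;> linarith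

/-- Atoms two levels deeper are definitely smaller. -/
lemma atomLen_le_of_subset (h : ReturnBounds e ρ A c) {n : ℕ} {Δ : AtomIdx ρ (n + 2)}
    {Δ' : AtomIdx ρ n} {m : ℤ} (hl : atomL e ρ c n Δ' + m ≤ atomL e ρ c (n + 2) Δ)
    (hr : atomR e ρ c (n + 2) Δ ≤ atomR e ρ c n Δ' + m) :
    0 < atomLen e ρ c n Δ' ∧
      atomLen e ρ c (n + 2) Δ ≤ (1 - (A ^ 2)⁻¹) * atomLen e ρ c n Δ' := by
  have hA := h.one_le
  have hq := fun k => qden_le_succ h.irrational h.mem_Ioo k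
  obtain ⟨t, M, ht, hL, hR⟩ := h.ordered.exists_atom_endpoints c n Δ'
  obtain ⟨ht1, ht2, ht3⟩ : t < qden ρ (M + 1) ∧ t + qden ρ M ≤ 2 * qden ρ (M + 1) ∧
      t + qden ρ (M + 2) < qden ρ (n + 2) + qden ρ (n + 3) := by
    rcases ht with ⟨ht, rfl⟩ | ⟨ht, rfl⟩
    · have h1 : qden ρ M ≤ qden ρ (M + 1) := hq M
      have h2 : qden ρ (M + 2) ≤ qden ρ (M + 3) := hq (M + 2)
      have h3 : qden ρ (M + 1) ≤ qden ρ (M + 2) := hq (M + 1)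
      exact ⟨ht, by omega, by omega⟩
    · have h1 : qden ρ n ≤ qden ρ (n + 1) := hq n
      have h2 : qden ρ (n + 1) ≤ qden ρ (n + 2) := hq (n + 1)
      rw [show n + 1 + 1 = n + 2 from rfl, show n + 1 + 2 = n + 3 from rfl]
      exact ⟨by omega, by omega, by omega⟩
  rw [hL] at hl
  rw [hR] at hr
  rw [atomLen, atomLen, hL, hR, max_sub_min_eq_abs]
  set x := orb e t 0 c with hx
  set y := ret e ρ M x with hy
  set v := ret e ρ (M + 2) x with hv
  have hyo : y = orb e (qden ρ M + t) (pnum ρ M) c := by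
    rw [hy, ret, hx, h.ordered.orb_orb, add_zero]
  have hangle := returnAngle_add_two ρ M
  have ha : (1 : ℝ) ≤ cfA ρ (M + 1) := by exact_mod_cast one_le_cfA h.irrational (M + 1)
  have hs := returnAngle_sign h.irrational h.mem_Ioo M
  have hs' := returnAngle_sign h.irrational h.mem_Ioo (M + 1)
  have hvm : v ∈ uIcc x y := by
    have := h.ordered.orb_mem_uIcc (q := qden ρ (M + 2)) (p := pnum ρ (M + 2))
      (q₁ := 0) (p₁ := 0) (q₂ := qden ρ M) (p₂ := pnum ρ M) (by
        simp only [returnAngle] at hs hs' hangle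
        rw [mem_uIcc]
        push_cast at *
        rcases hs with hs | hs
        · left; constructor
          · rcases hs' with hs' | hs' <;> linarith [hs.1, hs.2.1, hs'.1, hs'.2.1]
          · nlinarith [hs.2.1]
        · right; constructor
          · nlinarith [hs.2.1]
          · rcases hs' with hs' | hs' <;> linarith [hs.1, hs.2.1, hs'.1, hs'.2.1]) x
    rwa [orb_zero_zero] at this
  have hwm : ret e ρ (M + 1) y ∈ uIcc y v := by
    rw [hy, hv, ret, ret, ret, h.ordered.orb_orb _ _ _ _ x]
    refine h.ordered.orb_mem_uIcc ?_ x
    simp only [returnAngle] at hs hangle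
    rw [mem_uIcc]
    push_cast at *
    rcases hs with hs | hs
    · right; constructor
      · nlinarith [hs.2.1]
      · linarith [hs.2.1]
    · left; constructor
      · linarith [hs.2.1]
      · nlinarith [hs.2.1]
  have h1 : |y - x| ≤ A ^ 2 * |v - x| := by
    calc |y - x| ≤ A * (A * |v - x|) := by
          refine (h.le_succ' M (j := t) 0 (by positivity) (by omega)).trans ?_
          gcongr
          refine h.le_succ' (M + 1) (j := t) 0 (by positivity) ?_
          have : qden ρ (M + 1) ≤ qden ρ (M + 1 + 1) := hq (M + 1)
          omega
      _ = _ := by ring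
  have h2 : |y - x| ≤ A ^ 2 * |y - v| := by
    calc |y - x| ≤ A * (A * |y - v|) := by
          refine (h.comparable M x y right_mem_uIcc).1.trans ?_
          gcongr
          rw [hyo]
          refine (h.le_succ' M (pnum ρ M) (by positivity) (by omega)).trans ?_
          rw [← hyo, abs_sub_comm y v]
          exact mul_le_mul_of_nonneg_left (abs_sub_left_of_mem_uIcc hwm) (by linarith)
      _ = _ := by ring
  have hadd := abs_sub_eq_add_of_mem_uIcc hvm
  have hnot := h.orb_notMem_Ioo_atom n Δ (t := qden ρ (M + 2) + t) (k := pnum ρ (M + 2) - m)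
    (by positivity) (by omega)
  have hvo : v + m = orb e (qden ρ (M + 2) + t) (pnum ρ (M + 2) - m) c := by
    rw [hv, ret, hx, h.ordered.orb_orb, add_zero]
    simp only [orb]
    push_cast
    ring
  rw [← hvo] at hnot
  have hmax := sub_le_max_abs_of_notMem_Ioo hvm (a := atomL e ρ c (n + 2) Δ - m)
    (b := atomR e ρ c (n + 2) Δ - m) (by linarith) (by linarith)
    (fun hmem => hnot ⟨by linarith [hmem.1], by linarith [hmem.2]⟩)
  rw [sub_sub_sub_cancel_right] at hmax
  have hA2 : 0 < A ^ 2 := by positivity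
  refine ⟨?_, hmax.trans ?_⟩
  · rw [abs_pos, sub_ne_zero]
    intro hxy
    rcases hs with hs | hs
    · have := h.ordered.orb_lt_orb (q := 0) (p := 0) (q' := qden ρ M) (p' := pnum ρ M)
        (by simpa [returnAngle] using hs.1) x
      rw [orb_zero_zero] at this
      exact this.ne' hxy
    · have := h.ordered.orb_lt_orb (q := qden ρ M) (p := pnum ρ M) (q' := 0) (p' := 0)
        (by simpa [returnAngle] using hs.1) x
      rw [orb_zero_zero] at this
      exact this.ne hxy
  · rw [← inv_mul_le_iff₀ hA2] at h1 h2
    rw [max_le_iff]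
    constructor <;> linarith

end ReturnBounds

end Atoms

end MCircle

open MCircle

/-- **Real a-priori bounds** (Theorem 2.8). For a multicritical circle map `f` with
irrational rotation number there is `C₀ = C₀(f) > 1` such that for all `n ≥ 0` any two
adjacent atoms `I, J` of `𝒫ₙ` satisfy `C₀⁻¹|J| ≤ |I| ≤ C₀|J|`; in particular there is
`μ = μ(f) ∈ (0,1)` such that whenever an atom `Δ` of `𝒫_{n+2}` is contained in an atom
`Δ'` of `𝒫ₙ` one has `|Δ| < μ|Δ'|`. -/
theorem real_bounds (f : ℝ → ℝ) (C : Finset ℝ) (dc : ℝ → ℝ) (ρ : ℝ)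
    (hf : GoodMap f C dc ρ) :
    ∃ C₀ : ℝ, 1 < C₀ ∧ ∃ μ : ℝ, μ ∈ Ioo (0 : ℝ) 1 ∧
      ∀ c₀ ∈ C,
        (∀ n : ℕ, ∀ I J : AtomIdx ρ n, AdjacentAtoms f ρ c₀ n I J →
          C₀⁻¹ * atomLen f ρ c₀ n J ≤ atomLen f ρ c₀ n I ∧
          atomLen f ρ c₀ n I ≤ C₀ * atomLen f ρ c₀ n J) ∧
        (∀ n : ℕ, ∀ Δ : AtomIdx ρ (n + 2), ∀ Δ' : AtomIdx ρ n,
          (∃ m : ℤ, atomL f ρ c₀ n Δ' + (m : ℝ) ≤ atomL f ρ c₀ (n + 2) Δ ∧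
            atomR f ρ c₀ (n + 2) Δ ≤ atomR f ρ c₀ n Δ' + (m : ℝ)) →
          atomLen f ρ c₀ (n + 2) Δ < μ * atomLen f ρ c₀ n Δ') := by
  obtain ⟨e, hef, he, A, hA, hcomp, hsucc⟩ := exists_return_bounds hf
  obtain rfl : (e : ℝ → ℝ) = f := funext hef
  have hb : ∀ c ∈ C, ReturnBounds e ρ A c := fun c hc =>
    ⟨hA, hf.2.2.1, hf.2.2.2, he, hcomp, fun n => hsucc n c hc⟩
  have hA6 : 1 ≤ A ^ 6 := one_le_pow₀ hA
  have hA2 : 0 < (A ^ 2)⁻¹ := by positivity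
  have hA2' : (A ^ 2)⁻¹ ≤ 1 := inv_le_one_of_one_le₀ (one_le_pow₀ hA)
  have hlen : ∀ c n (I : AtomIdx ρ n), 0 ≤ atomLen e ρ c n I := fun c n I => by
    obtain ⟨t, M, -, hL, hR⟩ := he.exists_atom_endpoints c n I
    rw [atomLen, hL, hR]
    exact sub_nonneg.2 min_le_max
  refine ⟨A ^ 6 + 1, by linarith, 1 - (A ^ 2)⁻¹ / 2, ⟨by linarith, by linarith⟩, fun c hc =>
    ⟨fun n I J hIJ => ?_, fun n Δ Δ' ⟨m, hl, hr⟩ => ?_⟩⟩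
  · obtain ⟨h1, h2⟩ := (hb c hc).atomLen_le_of_adjacent hIJ
    rw [inv_mul_le_iff₀ (by linarith)]
    constructor
    · linarith [hlen c n I]
    · linarith [hlen c n J]
  · obtain ⟨h1, h2⟩ := (hb c hc).atomLen_le_of_subset hl hr
    have := mul_pos hA2 h1
    linarith
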